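/- There do not exist a nonempty open set U ⊆ ℝ³, real constants c ≠ c̃, and smooth functions v₁,v₂,v₃,V₁,V₂,V₃ : U → ℝ and h_{ij} : U → ℝ (1 ≤ i ≠ j ≤ 3) such that at every point of U all of the following hold: vᵢ > 0 and Vᵢ ≠ 0 for i = 1,2,3; the principal curvatures V₁/v₁, V₂/v₂, V₃/v₃ are pairwise distinct; the system (⋆) holds; and the PDE system holds: (i) ∂vᵢ/∂uⱼ = h_{ji} vⱼ for i ≠ j; (ii) ∂h_{ij}/∂uᵢ + ∂h_{ji}/∂uⱼ + h_{ki}h_{kj} + VᵢVⱼ + c vᵢvⱼ = 0 for pairwise distinct i,j,k; (iii) ∂h_{ik}/∂uⱼ = h_{ij}h_{jk} for pairwise distinct i,j,k; (iv) ∂Vᵢ/∂uⱼ = h_{ji}Vⱼ for i ≠ j; (v) δᵢ ∂vᵢ/∂uᵢ + δⱼ h_{ij}vⱼ + δₖ h_{ik}vₖ = 0 for pairwise distinct i,j,k; (vi) δᵢ ∂Vᵢ/∂uᵢ + δⱼ h_{ij}Vⱼ + δₖ h_{ik}Vₖ = 0 for pairwise distinct i,j,k. (This is the analytic content of the paper's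 Theorem: there exists no minimal hypersurface of Q⁴(c) with three nonzero distinct principal curvatures admitting an isometric immersion into Q⁴(c̃), c ≠ c̃.) -/

import Mathlib

/-- δ₁ = 1, δ₂ = −1, δ₃ = 1 (indices 0,1,2 in `Fin 3`). -/
noncomputable def delta : Fin 3 → ℝ := ![1, -1, 1]

noncomputable def pf (t : ℝ) : ℝ := (3 * t - 1) * (1 - t)

/-- the (cleared) Gauss equation for the pair `(i,j)` with third index `k` -/
noncomputable def EQ (ai aj ak zi zj ri rj rk c S : ℝ) : ℝ :=
  pf aj * zi + pf ai * zj
    + ri * (pf aj * (ai * pf aj + aj * pf aj + ak * pf ak + 2 * ai * aj * (4 - 6 * aj)))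
    + rj * (pf ai * (aj * pf ai + ai * pf ai + ak * pf ak + 2 * ai * aj * (4 - 6 * ai)))
    + rk * (ak * pf ai * pf aj) + c + S * ((aj - ak) * (ak - ai))

noncomputable def dEQ (ai aj ak zi zj ri rj rk S dai daj dak dzi dzj dri drj drk dS : ℝ) : ℝ :=
  (4 - 6 * aj) * daj * zi + pf aj * dzi + (4 - 6 * ai) * dai * zj + pf ai * dzj
    + dri * (pf aj * (ai * pf aj + aj * pf aj + ak * pf ak + 2 * ai * aj * (4 - 6 * aj)))
    + ri * ((4 - 6 * aj) * daj * (ai * pf aj + aj * pf aj + ak * pf ak + 2 * ai * aj * (4 - 6 * aj))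
      + pf aj * (dai * pf aj + ai * ((4 - 6 * aj) * daj) + daj * pf aj + aj * ((4 - 6 * aj) * daj)
        + dak * pf ak + ak * ((4 - 6 * ak) * dak) + 2 * dai * aj * (4 - 6 * aj)
        + 2 * ai * ((4 - 12 * aj) * daj)))
    + drj * (pf ai * (aj * pf ai + ai * pf ai + ak * pf ak + 2 * ai * aj * (4 - 6 * ai)))
    + rj * ((4 - 6 * ai) * dai * (aj * pf ai + ai * pf ai + ak * pf ak + 2 * ai * aj * (4 - 6 * ai))
      + pf ai * (daj * pf ai + aj * ((4 - 6 * ai) * dai) + dai * pf ai + ai * ((4 - 6 * ai) * dai)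
        + dak * pf ak + ak * ((4 - 6 * ak) * dak) + 2 * daj * ai * (4 - 6 * ai)
        + 2 * aj * ((4 - 12 * ai) * dai)))
    + drk * (ak * pf ai * pf aj)
    + rk * (dak * pf ai * pf aj + ak * ((4 - 6 * ai) * dai) * pf aj + ak * pf ai * ((4 - 6 * aj) * daj))
    + dS * ((aj - ak) * (ak - ai)) + S * ((daj - dak) * (ak - ai) + (aj - ak) * (dak - dai))

/-- `∂_k τ_i = τ_i τ_k ef ai aj ak` -/
noncomputable def ef (ai aj ak : ℝ) : ℝ := pf ak + pf ai - pf aj - 2 * aj * (4 - 6 * aj)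

noncomputable def efd (ai aj ak dai daj dak : ℝ) : ℝ :=
  (4 - 6 * ak) * dak + (4 - 6 * ai) * dai - (4 - 6 * aj) * daj - 2 * ((4 - 12 * aj) * daj)

/-- `∂_i (ef ai aj ak) / τ_i` -/
noncomputable def Dief (ai aj ak : ℝ) : ℝ :=
  efd ai aj ak (-2 * (aj * pf aj + ak * pf ak)) (2 * aj * pf aj) (2 * ak * pf ak)

noncomputable def DD (x y z : ℝ) : ℝ := x * pf x + y * pf y + z * pf z

noncomputable def Ac (x y : ℝ) : ℝ :=
  - 135*x^4*y - 9*x^4 - 135*x^3*y^2 + 135*x^3*y + 24*x^3 + 45*x^2*y - 21*x^2 + 45*x*y^2 - 51*x*y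
    + 6*x - 6*y^2 + 6*y
noncomputable def Bc (x y : ℝ) : ℝ :=
  - 90*x^3*y + 18*x^3 - 135*x^2*y^2 + 159*x^2*y - 24*x^2 - 45*x*y^3 + 102*x*y^2 - 63*x*y + 6*x
    + 9*y^3 - 15*y^2 + 6*y
noncomputable def Bc' (x y : ℝ) : ℝ :=
  45*x^3*y + 3*x^3 - 18*x^2*y - 6*x^2 - 45*x*y^3 + 60*x*y^2 - 18*x*y + 3*x + 9*y^3 - 12*y^2 + 3*y
noncomputable def Cc (x y : ℝ) : ℝ :=
  - 54*x^4*y - 18*x^4 - 54*x^3*y^2 + 207*x^3*y + 15*x^3 + 153*x^2*y^2 - 225*x^2*y + 8*x^2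
    - 72*x*y^2 + 77*x*y - 5*x + 5*y^2 - 5*y
noncomputable def Sc (x y : ℝ) : ℝ :=
  270*x^6*y - 18*x^6 + 135*x^5*y^2 - 756*x^5*y + 33*x^5 - 270*x^4*y^3 - 279*x^4*y^2 + 780*x^4*y
    - 7*x^4 - 135*x^3*y^4 + 144*x^3*y^3 + 384*x^3*y^2 - 428*x^3*y - 13*x^3 - 63*x^2*y^4
    + 324*x^2*y^3 - 408*x^2*y^2 + 178*x^2*y + 5*x^2 + 99*x*y^4 - 224*x*y^3 + 169*x*y^2 - 48*x*y
    - 13*y^4 + 26*y^3 - 17*y^2 + 4*y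

noncomputable def Lr (x y z Rx Ry Rz c S : ℝ) : ℝ :=
  (y - z) * Ac x y * Rx + pf x * Bc x y * Ry + pf x * Bc' x y * Rz + (y - z) * Cc x y * c
    + (y - z) * Sc x y * S

/-- combination of the three relations `L_k` -/
lemma Lr_comb (x y z R1 R2 R3 c S : ℝ) (h : x + y + z = 1) :
    (15 * y * z + 7 * x - 4) * Lr x y z R1 R2 R3 c S + (15 * x * z + 7 * y - 4) * Lr y z x R2 R3 R1 c S
     + (15 * x * y + 7 * z - 4) * Lr z x y R3 R1 R2 c S
     = -(S * ((3 * x - 1) * (3 * y - 1) * (3 * z - 1) * ((x - y) * (y - z) * (z - x)) *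
        (30 * ((1 - x) * (1 - y) * (1 - z)) - 8))) := by
  obtain rfl : z = 1 - x - y := by linarith
  unfold Lr Ac Bc Bc' Cc Sc pf
  ring

noncomputable def qf (t : ℝ) : ℝ := pf t + 2 * t * (4 - 6 * t)

noncomputable def lf (x y z : ℝ) : ℝ :=
  (4 - 6 * z) * (2 * z * pf z) * pf x - pf z * (4 - 6 * x) * (2 * (y * pf y + z * pf z))
    + pf z * pf x * (ef y z x - 2 * pf y)

noncomputable def Ex (x y z zi zj zk ri rj rk c S dzk drk dS : ℝ) : ℝ :=
  DD x y z * (2 * pf x * pf y * pf z * (pf z *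
      dEQ y x z zi zk ri rk rj S (2 * y * pf y) (-2 * (y * pf y + z * pf z))
      (2 * z * pf z) (zi * (ef y z x - 2 * pf y) + y * ri * (ef y z x ^ 2 + Dief y z x)) dzk
      (2 * ri * (ef y z x - 2 * pf y)) drk (2 * rj * (ef z y x - 2 * pf z)) dS
      + (4 - 6 * z) * (2 * z * pf z) * EQ y x z zi zk ri rk rj c S
        - pf y * dEQ z x y zj zk rj rk ri S (2 * z * pf z) (-2 * (y * pf y + z * pf z))
      (2 * y * pf y) (zj * (ef z y x - 2 * pf z) + z * rj * (ef z y x ^ 2 + Dief z y x)) dzk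
      (2 * rj * (ef z y x - 2 * pf z)) drk (2 * ri * (ef y z x - 2 * pf y)) dS
      - (4 - 6 * y) * (2 * y * pf y) * EQ z x y zj zk rj rk ri c S
        - pf y * pf z * (qf y - qf z) * (x * drk - 2 * (zk + 2 * rk * (y * pf y + z * pf z))))
      - (lf x y z * pf y * (pf x * EQ y z x zi zj ri rj rk c S
            + pf z * EQ y x z zi zk ri rk rj c S - pf y * EQ z x y zj zk rj rk ri c S)
        - lf x z y * pf z * (pf x * EQ y z x zi zj ri rj rk c S
            + pf y * EQ z x y zj zk rj rk ri c S - pf z * EQ y x z zi zk ri rk rj c S)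
        + 2 * pf y * pf z * (qf y - qf z) * pf x * (pf z * EQ y x z zi zk ri rk rj c S
            + pf y * EQ z x y zj zk rj rk ri c S - pf x * EQ y z x zi zj ri rj rk c S)))
      - 2 * pf x * pf y * pf z * (pf z * ((x - z) * (z - y)) - pf y * ((x - y) * (y - z))) *
        (dS * DD x y z + S * (
      ((-9 * x ^ 2 + 8 * x - 1) * (-2 * (y * pf y + z * pf z))
        + (-9 * y ^ 2 + 8 * y - 1) * (2 * y * pf y) + (-9 * z ^ 2 + 8 * z - 1) * (2 * z * pf z))))
    - 8 * pf y * pf z * DD x y z *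
      Lr x y z (x * rk * pf y * pf z) (y * ri * pf x * pf z) (z * rj * pf x * pf y) c S

set_option maxHeartbeats 1000000 in
lemma Ex_lin (x y z zi zj zk ri rj rk c S dzk drk dS : ℝ) :
    Ex x y z zi zj zk ri rj rk c S dzk drk dS =
      zi * Ex x y z 1 0 0 0 0 0 0 0 0 0 0 + zj * Ex x y z 0 1 0 0 0 0 0 0 0 0 0
      + zk * Ex x y z 0 0 1 0 0 0 0 0 0 0 0 + ri * Ex x y z 0 0 0 1 0 0 0 0 0 0 0
      + rj * Ex x y z 0 0 0 0 1 0 0 0 0 0 0 + rk * Ex x y z 0 0 0 0 0 1 0 0 0 0 0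
      + c * Ex x y z 0 0 0 0 0 0 1 0 0 0 0 + S * Ex x y z 0 0 0 0 0 0 0 1 0 0 0
      + dzk * Ex x y z 0 0 0 0 0 0 0 0 1 0 0 + drk * Ex x y z 0 0 0 0 0 0 0 0 0 1 0
      + dS * Ex x y z 0 0 0 0 0 0 0 0 0 0 1 := by
  unfold Ex dEQ EQ Lr
  generalize DD x y z = D, pf x = px, pf y = py, pf z = pz, ef y z x = e1, ef z y x = e2,
    Dief y z x = D1, Dief z y x = D2, lf x y z = l1, lf x z y = l2, qf y = qy, qf z = qz,
    Ac x y = A1, Bc x y = A2, Bc' x y = A3, Cc x y = A4, Sc x y = A5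
  ring1

set_option maxRecDepth 100000 in
set_option maxHeartbeats 1000000 in
lemma Ex_zi (x y : ℝ) : Ex x y (1 - x - y) 1 0 0 0 0 0 0 0 0 0 0 = 0 := by
  unfold Ex lf Lr Ac Bc Bc' Cc Sc dEQ EQ Dief efd ef qf DD pf
  ring1

set_option maxRecDepth 100000 in
set_option maxHeartbeats 1000000 in
lemma Ex_zj (x y : ℝ) : Ex x y (1 - x - y) 0 1 0 0 0 0 0 0 0 0 0 = 0 := by
  unfold Ex lf Lr Ac Bc Bc' Cc Sc dEQ EQ Dief efd ef qf DD pf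
  ring1

set_option maxRecDepth 100000 in
set_option maxHeartbeats 1000000 in
lemma Ex_zk (x y : ℝ) : Ex x y (1 - x - y) 0 0 1 0 0 0 0 0 0 0 0 = 0 := by
  unfold Ex lf Lr Ac Bc Bc' Cc Sc dEQ EQ Dief efd ef qf DD pf
  ring1

set_option maxRecDepth 100000 in
set_option maxHeartbeats 1000000 in
lemma Ex_ri (x y : ℝ) : Ex x y (1 - x - y) 0 0 0 1 0 0 0 0 0 0 0 = 0 := by
  unfold Ex lf Lr Ac Bc Bc' Cc Sc dEQ EQ Dief efd ef qf DD pf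
  ring1

set_option maxRecDepth 100000 in
set_option maxHeartbeats 1000000 in
lemma Ex_rj (x y : ℝ) : Ex x y (1 - x - y) 0 0 0 0 1 0 0 0 0 0 0 = 0 := by
  unfold Ex lf Lr Ac Bc Bc' Cc Sc dEQ EQ Dief efd ef qf DD pf
  ring1

set_option maxRecDepth 100000 in
set_option maxHeartbeats 1000000 in
lemma Ex_rk (x y : ℝ) : Ex x y (1 - x - y) 0 0 0 0 0 1 0 0 0 0 0 = 0 := by
  unfold Ex lf Lr Ac Bc Bc' Cc Sc dEQ EQ Dief efd ef qf DD pf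
  ring1

set_option maxRecDepth 100000 in
set_option maxHeartbeats 1000000 in
lemma Ex_c (x y : ℝ) : Ex x y (1 - x - y) 0 0 0 0 0 0 1 0 0 0 0 = 0 := by
  unfold Ex lf Lr Ac Bc Bc' Cc Sc dEQ EQ Dief efd ef qf DD pf
  ring1

set_option maxRecDepth 100000 in
set_option maxHeartbeats 1000000 in
lemma Ex_S (x y : ℝ) : Ex x y (1 - x - y) 0 0 0 0 0 0 0 1 0 0 0 = 0 := by
  unfold Ex lf Lr Ac Bc Bc' Cc Sc dEQ EQ Dief efd ef qf DD pf
  ring1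

set_option maxRecDepth 100000 in
set_option maxHeartbeats 1000000 in
lemma Ex_dzk (x y : ℝ) : Ex x y (1 - x - y) 0 0 0 0 0 0 0 0 1 0 0 = 0 := by
  unfold Ex lf Lr Ac Bc Bc' Cc Sc dEQ EQ Dief efd ef qf DD pf
  ring1

set_option maxRecDepth 100000 in
set_option maxHeartbeats 1000000 in
lemma Ex_drk (x y : ℝ) : Ex x y (1 - x - y) 0 0 0 0 0 0 0 0 0 1 0 = 0 := by
  unfold Ex lf Lr Ac Bc Bc' Cc Sc dEQ EQ Dief efd ef qf DD pf
  ring1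

set_option maxRecDepth 100000 in
set_option maxHeartbeats 1000000 in
lemma Ex_dS (x y : ℝ) : Ex x y (1 - x - y) 0 0 0 0 0 0 0 0 0 0 1 = 0 := by
  unfold Ex lf Lr Ac Bc Bc' Cc Sc dEQ EQ Dief efd ef qf DD pf
  ring1

lemma Ex_zero (x y z zi zj zk ri rj rk c S dzk drk dS : ℝ) (hs : x + y + z = 1) :
    Ex x y z zi zj zk ri rj rk c S dzk drk dS = 0 := by
  obtain rfl : z = 1 - x - y := by linarith
  rw [Ex_lin, Ex_zi, Ex_zj, Ex_zk, Ex_ri, Ex_rj, Ex_rk, Ex_c, Ex_S, Ex_dzk, Ex_drk, Ex_dS]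
  ring

lemma dEQ_smul (t ai aj ak zi zj ri rj rk S dai daj dak dzi dzj dri drj drk dS : ℝ) :
    dEQ ai aj ak zi zj ri rj rk S (t * dai) (t * daj) (t * dak) (t * dzi) (t * dzj) (t * dri)
      (t * drj) (t * drk) (t * dS) =
    t * dEQ ai aj ak zi zj ri rj rk S dai daj dak dzi dzj dri drj drk dS := by
  unfold dEQ; ring

lemma Lpure (x y z t zi zj zk ri rj rk c S dzk drk dS : ℝ) (hs : x + y + z = 1)
    (ht : t ≠ 0) (hpy : pf y ≠ 0) (hpz : pf z ≠ 0) (hD : DD x y z ≠ 0)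
    (h1 : EQ y z x zi zj ri rj rk c S = 0) (h2 : EQ y x z zi zk ri rk rj c S = 0)
    (h3 : EQ z x y zj zk rj rk ri c S = 0)
    (hrk : x * drk = 2 * t * (zk + 2 * rk * (y * pf y + z * pf z)))
    (hS : dS * DD x y z = - S * (t *
      ((-9 * x ^ 2 + 8 * x - 1) * (-2 * (y * pf y + z * pf z))
        + (-9 * y ^ 2 + 8 * y - 1) * (2 * y * pf y) + (-9 * z ^ 2 + 8 * z - 1) * (2 * z * pf z))))
    (d2 : dEQ y x z zi zk ri rk rj S (2 * t * y * pf y) (-2 * t * (y * pf y + z * pf z))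
      (2 * t * z * pf z) (t * (zi * (ef y z x - 2 * pf y) + y * ri * (ef y z x ^ 2 + Dief y z x))) dzk
      (2 * t * ri * (ef y z x - 2 * pf y)) drk (2 * t * rj * (ef z y x - 2 * pf z)) dS = 0)
    (d3 : dEQ z x y zj zk rj rk ri S (2 * t * z * pf z) (-2 * t * (y * pf y + z * pf z))
      (2 * t * y * pf y) (t * (zj * (ef z y x - 2 * pf z) + z * rj * (ef z y x ^ 2 + Dief z y x))) dzk
      (2 * t * rj * (ef z y x - 2 * pf z)) drk (2 * t * ri * (ef y z x - 2 * pf y)) dS = 0) :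
    Lr x y z (x * rk * pf y * pf z) (y * ri * pf x * pf z) (z * rj * pf x * pf y) c S = 0 := by
  obtain ⟨dzk, rfl⟩ : ∃ u, dzk = t * u := ⟨dzk / t, by field_simp⟩
  obtain ⟨drk, rfl⟩ : ∃ u, drk = t * u := ⟨drk / t, by field_simp⟩
  obtain ⟨dS, rfl⟩ : ∃ u, dS = t * u := ⟨dS / t, by field_simp⟩
  have d2' := (dEQ_smul t y x z zi zk ri rk rj S (2 * y * pf y) (-2 * (y * pf y + z * pf z))
      (2 * z * pf z) (zi * (ef y z x - 2 * pf y) + y * ri * (ef y z x ^ 2 + Dief y z x)) dzk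
      (2 * ri * (ef y z x - 2 * pf y)) drk (2 * rj * (ef z y x - 2 * pf z)) dS).symm.trans
      (Eq.trans (by congr 1 <;> ring) d2)
  have d3' := (dEQ_smul t z x y zj zk rj rk ri S (2 * z * pf z) (-2 * (y * pf y + z * pf z))
      (2 * y * pf y) (zj * (ef z y x - 2 * pf z) + z * rj * (ef z y x ^ 2 + Dief z y x)) dzk
      (2 * rj * (ef z y x - 2 * pf z)) drk (2 * ri * (ef y z x - 2 * pf y)) dS).symm.trans
      (Eq.trans (by congr 1 <;> ring) d3)
  have d2'' := (mul_eq_zero.mp d2').resolve_left ht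
  have d3'' := (mul_eq_zero.mp d3').resolve_left ht
  have hrk' : x * drk - 2 * (zk + 2 * rk * (y * pf y + z * pf z)) = 0 := by
    apply mul_left_cancel₀ ht; linear_combination hrk
  have hS' : dS * DD x y z + S * (
      ((-9 * x ^ 2 + 8 * x - 1) * (-2 * (y * pf y + z * pf z))
        + (-9 * y ^ 2 + 8 * y - 1) * (2 * y * pf y)
        + (-9 * z ^ 2 + 8 * z - 1) * (2 * z * pf z))) = 0 := by
    apply mul_left_cancel₀ ht; linear_combination hS
  have key := Ex_zero x y z zi zj zk ri rj rk c S dzk drk dS hs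
  unfold Ex at key
  rw [d2'', d3'', hrk', hS', h1, h2, h3] at key
  have h0 : 8 * pf y * pf z * DD x y z ≠ 0 := by positivity
  apply mul_left_cancel₀ h0
  linear_combination -key

/-- points of `ℝ³` -/
abbrev E3 : Type := Fin 3 → ℝ

/-- directional derivative relation: `∂f/∂u_j (x) = d` -/
def PD (f : E3 → ℝ) (j : Fin 3) (x : E3) (d : ℝ) : Prop :=
  HasDerivAt (fun t : ℝ => f (x + t • (Pi.single j 1 : E3))) d 0

lemma PD.add {f g : E3 → ℝ} {j : Fin 3} {x : E3} {d e : ℝ} (hf : PD f j x d) (hg : PD g j x e) :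
    PD (fun y => f y + g y) j x (d + e) := HasDerivAt.fun_add hf hg

lemma PD.sub {f g : E3 → ℝ} {j : Fin 3} {x : E3} {d e : ℝ} (hf : PD f j x d) (hg : PD g j x e) :
    PD (fun y => f y - g y) j x (d - e) := HasDerivAt.fun_sub hf hg

lemma PD.mul {f g : E3 → ℝ} {j : Fin 3} {x : E3} {d e : ℝ} (hf : PD f j x d) (hg : PD g j x e) :
    PD (fun y => f y * g y) j x (d * g x + f x * e) := by
  have := HasDerivAt.fun_mul hf hg
  simpa [PD] using this

lemma PD.div {f g : E3 → ℝ} {j : Fin 3} {x : E3} {d e : ℝ} (hf : PD f j x d) (hg : PD g j x e)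
    (h0 : g x ≠ 0) :
    PD (fun y => f y / g y) j x ((d * g x - f x * e) / g x ^ 2) := by
  have := HasDerivAt.fun_div hf hg (by simpa using h0)
  simpa [PD] using this

lemma PD.const (r : ℝ) (j : Fin 3) (x : E3) : PD (fun _ => r) j x 0 := hasDerivAt_const _ _

lemma PD.cmul {f : E3 → ℝ} {j : Fin 3} {x : E3} {d : ℝ} (r : ℝ) (hf : PD f j x d) :
    PD (fun y => r * f y) j x (r * d) := HasDerivAt.const_mul r hf

lemma PD.comp {f : E3 → ℝ} {j : Fin 3} {x : E3} {d : ℝ} {φ : ℝ → ℝ} {φ' : ℝ} (hf : PD f j x d)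
    (hφ : HasDerivAt φ φ' (f x)) : PD (fun y => φ (f y)) j x (φ' * d) := by
  have h2 : HasDerivAt φ φ' ((fun t : ℝ => f (x + t • (Pi.single j 1 : E3))) 0) := by simpa using hφ
  exact HasDerivAt.comp (0 : ℝ) h2 hf

lemma PD.sq {f : E3 → ℝ} {j : Fin 3} {x : E3} {d : ℝ} (hf : PD f j x d) :
    PD (fun y => f y ^ 2) j x (2 * f x * d) :=
  hf.comp (by simpa using hasDerivAt_pow 2 (f x))

lemma PD.unique {f : E3 → ℝ} {j : Fin 3} {x : E3} {d e : ℝ} (hf : PD f j x d) (hg : PD f j x e) :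
    d = e := HasDerivAt.unique hf hg

lemma PD.of_eq {f : E3 → ℝ} {j : Fin 3} {x : E3} {d e : ℝ} (hf : PD f j x d) (h : d = e) :
    PD f j x e := h ▸ hf

lemma line_mem {W : Set E3} (hW : IsOpen W) {x : E3} (hx : x ∈ W) (j : Fin 3) :
    ∀ᶠ t : ℝ in nhds 0, x + t • (Pi.single j 1 : E3) ∈ W := by
  have hc : Continuous fun t : ℝ => x + t • (Pi.single j 1 : E3) := by fun_prop
  exact hc.continuousAt.eventually (hW.mem_nhds (by simpa using hx))

lemma PD.congr {f g : E3 → ℝ} {j : Fin 3} {x : E3} {d : ℝ} {W : Set E3} (hW : IsOpen W)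
    (hx : x ∈ W) (h : ∀ y ∈ W, f y = g y) (hf : PD f j x d) : PD g j x d := by
  refine HasDerivAt.congr_of_eventuallyEq hf ?_
  filter_upwards [line_mem hW hx j] with t ht
  exact (h _ ht).symm

lemma PD.eq_zero {f : E3 → ℝ} {j : Fin 3} {x : E3} {d r : ℝ} {W : Set E3} (hW : IsOpen W)
    (hx : x ∈ W) (h : ∀ y ∈ W, f y = r) (hf : PD f j x d) : d = 0 :=
  (PD.congr hW hx h hf).unique (PD.const r j x)

lemma PD.of_diff {f : E3 → ℝ} {x : E3} (hf : DifferentiableAt ℝ f x) (j : Fin 3) :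
    PD f j x (fderiv ℝ f x (Pi.single j 1)) :=
  hf.hasFDerivAt.hasLineDerivAt _

lemma PD.of_smooth {f : E3 → ℝ} {W : Set E3} (hW : IsOpen W)
    (hf : ContDiffOn ℝ (⊤ : ℕ∞) f W) {x : E3} (hx : x ∈ W) (j : Fin 3) :
    PD f j x (fderiv ℝ f x (Pi.single j 1)) :=
  PD.of_diff ((hf.contDiffAt (hW.mem_nhds hx)).differentiableAt (by simp)) j

lemma smooth_pd {f : E3 → ℝ} {W : Set E3} (hW : IsOpen W)
    (hf : ContDiffOn ℝ (⊤ : ℕ∞) f W) (j : Fin 3) :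
    ContDiffOn ℝ (⊤ : ℕ∞) (fun x => fderiv ℝ f x (Pi.single j 1)) W :=
  (hf.fderiv_of_isOpen hW (by simp)).clm_apply contDiffOn_const

/-- symmetry of second derivatives -/
lemma PD_symm {f : E3 → ℝ} {W : Set E3} (hW : IsOpen W)
    (hf : ContDiffOn ℝ (⊤ : ℕ∞) f W) {x : E3} (hx : x ∈ W) {i k : Fin 3} {d : ℝ}
    (h : PD (fun y => fderiv ℝ f y (Pi.single k 1)) i x d) :
    PD (fun y => fderiv ℝ f y (Pi.single i 1)) k x d := by
  have h1 : DifferentiableAt ℝ (fderiv ℝ f) x :=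
    ((hf.fderiv_of_isOpen hW (m := (⊤ : ℕ∞)) (by simp)).contDiffAt
      (hW.mem_nhds hx)).differentiableAt (by simp)
  have hs : IsSymmSndFDerivAt ℝ f x :=
    (hf.contDiffAt (hW.mem_nhds hx)).isSymmSndFDerivAt (by
      simp only [minSmoothness_of_isRCLikeNormedField]
      exact WithTop.coe_le_coe.2 (le_top : (2 : ℕ∞) ≤ ⊤))
  have hd : ∀ j l : Fin 3, PD (fun y => fderiv ℝ f y (Pi.single l 1)) j x
      (fderiv ℝ (fderiv ℝ f) x (Pi.single j 1) (Pi.single l 1)) := by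
    intro j l
    have h2 : HasFDerivAt (fun y => fderiv ℝ f y (Pi.single l 1))
        ((fderiv ℝ (fderiv ℝ f) x).flip (Pi.single l 1)) x := by
      have := h1.hasFDerivAt.clm_apply (hasFDerivAt_const (Pi.single l 1 : E3) x)
      simpa using this
    exact h2.hasLineDerivAt _
  refine (hd k i).of_eq ?_
  rw [hs.eq]
  exact (hd i k).unique h

lemma pf_deriv (t : ℝ) : HasDerivAt pf (4 - 6 * t) t := by
  unfold pf
  have h1 : HasDerivAt (fun t : ℝ => 3 * t - 1) 3 t := by
    simpa using ((hasDerivAt_id t).const_mul 3).sub_const 1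
  have h2 : HasDerivAt (fun t : ℝ => 1 - t) (-1) t := by
    simpa using (hasDerivAt_id t).const_sub 1
  exact (h1.fun_mul h2).congr_deriv (by ring)

lemma PD.pf {f : E3 → ℝ} {j : Fin 3} {x : E3} {d : ℝ} (hf : PD f j x d) :
    PD (fun y => pf (f y)) j x ((4 - 6 * f x) * d) := hf.comp (pf_deriv _)

set_option maxHeartbeats 1000000 in
lemma PD_EQ {ai aj ak zi zj ri rj rk S : E3 → ℝ} {c : ℝ}
    {dai daj dak dzi dzj dri drj drk dS : ℝ} {l : Fin 3} {x : E3}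
    (h1 : PD ai l x dai) (h2 : PD aj l x daj) (h3 : PD ak l x dak) (h4 : PD zi l x dzi)
    (h5 : PD zj l x dzj) (h6 : PD ri l x dri) (h7 : PD rj l x drj) (h8 : PD rk l x drk)
    (h9 : PD S l x dS) :
    PD (fun y => EQ (ai y) (aj y) (ak y) (zi y) (zj y) (ri y) (rj y) (rk y) c (S y)) l x
      (dEQ (ai x) (aj x) (ak x) (zi x) (zj x) (ri x) (rj x) (rk x) (S x)
        dai daj dak dzi dzj dri drj drk dS) := by
  have q1 := (h2.pf.mul h4).add (h1.pf.mul h5)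
  have c1 := (((h1.mul h2.pf).add (h2.mul h2.pf)).add (h3.mul h3.pf)).add
    (((h1.cmul 2).mul h2).mul ((PD.const 4 l x).sub (h2.cmul 6)))
  have c2 := (((h2.mul h1.pf).add (h1.mul h1.pf)).add (h3.mul h3.pf)).add
    (((h1.cmul 2).mul h2).mul ((PD.const 4 l x).sub (h1.cmul 6)))
  have q2 := ((((q1.add (h6.mul (h2.pf.mul c1))).add (h7.mul (h1.pf.mul c2))).add
    (h8.mul ((h3.mul h1.pf).mul h2.pf))).add (PD.const c l x)).add
    (h9.mul ((h2.sub h3).mul (h3.sub h1)))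
  refine q2.of_eq ?_
  unfold dEQ
  ring

lemma PD_ef {ai aj ak : E3 → ℝ} {dai daj dak : ℝ} {l : Fin 3} {x : E3}
    (h1 : PD ai l x dai) (h2 : PD aj l x daj) (h3 : PD ak l x dak) :
    PD (fun y => ef (ai y) (aj y) (ak y)) l x (efd (ai x) (aj x) (ak x) dai daj dak) := by
  have q := ((h3.pf.add h1.pf).sub h2.pf).sub
    ((h2.cmul 2).mul ((PD.const 4 l x).sub (h2.cmul 6)))
  refine q.of_eq ?_
  unfold efd
  ring

lemma PD_DD {ai aj ak : E3 → ℝ} {dai daj dak : ℝ} {l : Fin 3} {x : E3}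
    (h1 : PD ai l x dai) (h2 : PD aj l x daj) (h3 : PD ak l x dak) :
    PD (fun y => DD (ai y) (aj y) (ak y)) l x
      ((-9 * ai x ^ 2 + 8 * ai x - 1) * dai + (-9 * aj x ^ 2 + 8 * aj x - 1) * daj
        + (-9 * ak x ^ 2 + 8 * ak x - 1) * dak) := by
  have q := ((h1.mul h1.pf).add (h2.mul h2.pf)).add (h3.mul h3.pf)
  refine q.of_eq ?_
  unfold _root_.pf
  ring

noncomputable def zf (ε : Fin 3 → ℝ) (a τ : Fin 3 → E3 → ℝ) (i : Fin 3) (x : E3) : ℝ :=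
  ε i * fderiv ℝ (τ i) x (Pi.single i 1) / a i x

noncomputable def rf (ε : Fin 3 → ℝ) (a τ : Fin 3 → E3 → ℝ) (i : Fin 3) (x : E3) : ℝ :=
  ε i * τ i x ^ 2 / a i x ^ 2

noncomputable def Sf (K : ℝ) (a : Fin 3 → E3 → ℝ) (x : E3) : ℝ :=
  K / DD (a 0 x) (a 1 x) (a 2 x)

/-- the reduced system -/
structure Sys (W : Set E3) (c K : ℝ) (ε : Fin 3 → ℝ) (a τ : Fin 3 → E3 → ℝ) : Prop where
  hW : IsOpen W
  hK : K ≠ 0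
  sa : ∀ i, ContDiffOn ℝ (⊤ : ℕ∞) (a i) W
  st : ∀ i, ContDiffOn ℝ (⊤ : ℕ∞) (τ i) W
  sum : ∀ x ∈ W, a 0 x + a 1 x + a 2 x = 1
  ne : ∀ x ∈ W, ∀ i, a i x ≠ 0
  pne : ∀ x ∈ W, ∀ i, pf (a i x) ≠ 0
  dne : ∀ x ∈ W, ∀ i j, i ≠ j → a i x ≠ a j x
  Dne : ∀ x ∈ W, DD (a 0 x) (a 1 x) (a 2 x) ≠ 0
  da : ∀ x ∈ W, ∀ i j, i ≠ j → PD (a j) i x (2 * τ i x * a j x * pf (a j x))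
  da' : ∀ x ∈ W, ∀ i j k, i ≠ j → j ≠ k → i ≠ k →
    PD (a i) i x (-2 * τ i x * (a j x * pf (a j x) + a k x * pf (a k x)))
  dt : ∀ x ∈ W, ∀ i j k, i ≠ j → j ≠ k → i ≠ k →
    PD (τ i) k x (τ i x * τ k x * ef (a i x) (a j x) (a k x))
  gauss : ∀ x ∈ W, ∀ i j k, i ≠ j → j ≠ k → i ≠ k →
    EQ (a i x) (a j x) (a k x) (zf ε a τ i x) (zf ε a τ j x) (rf ε a τ i x) (rf ε a τ j x)
      (rf ε a τ k x) c (Sf K a x) = 0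

lemma perm3 : ∀ i j k : Fin 3, i ≠ j → j ≠ k → i ≠ k →
    (i = 0 ∧ j = 1 ∧ k = 2) ∨ (i = 0 ∧ j = 2 ∧ k = 1) ∨ (i = 1 ∧ j = 0 ∧ k = 2) ∨
    (i = 1 ∧ j = 2 ∧ k = 0) ∨ (i = 2 ∧ j = 0 ∧ k = 1) ∨ (i = 2 ∧ j = 1 ∧ k = 0) := by decide

lemma sum_perm (f : Fin 3 → ℝ) {i j k : Fin 3} (h1 : i ≠ j) (h2 : j ≠ k) (h3 : i ≠ k) :
    f i + f j + f k = f 0 + f 1 + f 2 := by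
  rcases perm3 i j k h1 h2 h3 with ⟨rfl, rfl, rfl⟩ | ⟨rfl, rfl, rfl⟩ | ⟨rfl, rfl, rfl⟩ |
    ⟨rfl, rfl, rfl⟩ | ⟨rfl, rfl, rfl⟩ | ⟨rfl, rfl, rfl⟩ <;> ring

lemma DD_perm (a : Fin 3 → E3 → ℝ) (x : E3) {i j k : Fin 3} (h1 : i ≠ j) (h2 : j ≠ k)
    (h3 : i ≠ k) : DD (a i x) (a j x) (a k x) = DD (a 0 x) (a 1 x) (a 2 x) :=
  sum_perm (fun l => a l x * pf (a l x)) h1 h2 h3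

lemma ef_symm (x y z : ℝ) : ef x y z = ef z y x := by unfold ef; ring

namespace Sys

variable {W : Set E3} {c K : ℝ} {ε : Fin 3 → ℝ} {a τ : Fin 3 → E3 → ℝ}

lemma mono (s : Sys W c K ε a τ) {W' : Set E3} (ho : IsOpen W') (h : W' ⊆ W) :
    Sys W' c K ε a τ where
  hW := ho
  hK := s.hK
  sa i := (s.sa i).mono h
  st i := (s.st i).mono h
  sum x hx := s.sum x (h hx)
  ne x hx := s.ne x (h hx)
  pne x hx := s.pne x (h hx)
  dne x hx := s.dne x (h hx)
  Dne x hx := s.Dne x (h hx)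
  da x hx := s.da x (h hx)
  da' x hx := s.da' x (h hx)
  dt x hx := s.dt x (h hx)
  gauss x hx := s.gauss x (h hx)

lemma sum' (s : Sys W c K ε a τ) {x : E3} (hx : x ∈ W) {i j k : Fin 3} (h1 : i ≠ j) (h2 : j ≠ k)
    (h3 : i ≠ k) : a i x + a j x + a k x = 1 :=
  (sum_perm (fun l => a l x) h1 h2 h3).trans (s.sum x hx)

lemma Dne' (s : Sys W c K ε a τ) {x : E3} (hx : x ∈ W) {i j k : Fin 3} (h1 : i ≠ j) (h2 : j ≠ k)
    (h3 : i ≠ k) : DD (a i x) (a j x) (a k x) ≠ 0 := by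
  rw [DD_perm a x h1 h2 h3]; exact s.Dne x hx

lemma S_eq (s : Sys W c K ε a τ) {x : E3} (hx : x ∈ W) {i j k : Fin 3} (h1 : i ≠ j) (h2 : j ≠ k)
    (h3 : i ≠ k) : Sf K a x * DD (a i x) (a j x) (a k x) = K := by
  rw [DD_perm a x h1 h2 h3]; exact div_mul_cancel₀ _ (s.Dne x hx)

lemma S_ne (s : Sys W c K ε a τ) {x : E3} (hx : x ∈ W) : Sf K a x ≠ 0 :=
  div_ne_zero s.hK (s.Dne x hx)

lemma t_self (s : Sys W c K ε a τ) {x : E3} (hx : x ∈ W) (i : Fin 3) :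
    PD (τ i) i x (fderiv ℝ (τ i) x (Pi.single i 1)) := PD.of_smooth s.hW (s.st i) hx i

/-- `∂_k ∂_i τ_i` -/
lemma dX (s : Sys W c K ε a τ) {x : E3} (hx : x ∈ W) {i j k : Fin 3} (h1 : i ≠ j) (h2 : j ≠ k)
    (h3 : i ≠ k) : PD (fun y => fderiv ℝ (τ i) y (Pi.single i 1)) k x
      (τ k x * (fderiv ℝ (τ i) x (Pi.single i 1) * ef (a i x) (a j x) (a k x)
        + τ i x ^ 2 * (ef (a i x) (a j x) (a k x) ^ 2 + Dief (a i x) (a j x) (a k x)))) := by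
  apply PD_symm s.hW (s.st i) hx
  have q := ((s.t_self hx i).mul (s.dt x hx k j i h2.symm h1.symm h3.symm)).mul
    (PD_ef (s.da' x hx i j k h1 h2 h3) (s.da x hx i j h1) (s.da x hx i k h3))
  refine (PD.congr s.hW hx (fun y hy => ?_) q).of_eq ?_
  · exact (s.dt y hy i j k h1 h2 h3).unique (PD.of_smooth s.hW (s.st i) hy k)
  · rw [ef_symm (a k x)]
    unfold Dief efd
    ring

lemma dz (s : Sys W c K ε a τ) {x : E3} (hx : x ∈ W) {i j k : Fin 3} (h1 : i ≠ j) (h2 : j ≠ k)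
    (h3 : i ≠ k) : PD (zf ε a τ i) k x
      (τ k x * (zf ε a τ i x * (ef (a i x) (a j x) (a k x) - 2 * pf (a i x))
        + a i x * rf ε a τ i x *
          (ef (a i x) (a j x) (a k x) ^ 2 + Dief (a i x) (a j x) (a k x)))) := by
  have ha := s.ne x hx i
  have q := ((s.dX hx h1 h2 h3).cmul (ε i)).div (s.da x hx k i h3.symm) ha
  refine PD.of_eq (f := zf ε a τ i) q ?_
  unfold zf rf
  field_simp
  ring

lemma dr (s : Sys W c K ε a τ) {x : E3} (hx : x ∈ W) {i j k : Fin 3} (h1 : i ≠ j) (h2 : j ≠ k)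
    (h3 : i ≠ k) : PD (rf ε a τ i) k x
      (2 * τ k x * rf ε a τ i x * (ef (a i x) (a j x) (a k x) - 2 * pf (a i x))) := by
  have ha := s.ne x hx i
  have q := ((s.dt x hx i j k h1 h2 h3).sq.cmul (ε i)).div (s.da x hx k i h3.symm).sq
    (pow_ne_zero 2 ha)
  refine PD.of_eq (f := rf ε a τ i) q ?_
  unfold rf
  field_simp

lemma dr_self (s : Sys W c K ε a τ) {x : E3} (hx : x ∈ W) {i j k : Fin 3} (h1 : i ≠ j)
    (h2 : j ≠ k) (h3 : i ≠ k) : ∃ d, PD (rf ε a τ k) k x d ∧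
      a k x * d = 2 * τ k x * (zf ε a τ k x + 2 * rf ε a τ k x *
        (a i x * pf (a i x) + a j x * pf (a j x))) := by
  have ha := s.ne x hx k
  have q := ((s.t_self hx k).sq.cmul (ε k)).div (s.da' x hx k i j h3.symm h1 h2.symm).sq
    (pow_ne_zero 2 ha)
  refine ⟨_, q, ?_⟩
  unfold rf zf
  field_simp
  ring

lemma dS (s : Sys W c K ε a τ) {x : E3} (hx : x ∈ W) {i j k : Fin 3} (h1 : i ≠ j)
    (h2 : j ≠ k) (h3 : i ≠ k) : ∃ d, PD (Sf K a) k x d ∧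
      d * DD (a k x) (a i x) (a j x) = - Sf K a x * (τ k x *
      ((-9 * a k x ^ 2 + 8 * a k x - 1) * (-2 * (a i x * pf (a i x) + a j x * pf (a j x)))
        + (-9 * a i x ^ 2 + 8 * a i x - 1) * (2 * a i x * pf (a i x))
        + (-9 * a j x ^ 2 + 8 * a j x - 1) * (2 * a j x * pf (a j x)))) := by
  have hD := s.Dne' hx h3.symm h1 h2.symm
  have q := (PD.const K k x).div (PD_DD (s.da' x hx k i j h3.symm h1 h2.symm)
    (s.da x hx k i h3.symm) (s.da x hx k j h2.symm)) hD
  have hf : Sf K a = fun y => K / DD (a k y) (a i y) (a j y) := by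
    funext y; unfold Sf; rw [DD_perm a y h3.symm h1 h2.symm]
  rw [hf]
  refine ⟨_, q, ?_⟩
  field_simp
  ring

/-- the relation `L_k` -/
lemma Lk (s : Sys W c K ε a τ) {x : E3} (hx : x ∈ W) {i j k : Fin 3} (h1 : i ≠ j)
    (h2 : j ≠ k) (h3 : i ≠ k) (ht : τ k x ≠ 0) :
    Lr (a k x) (a i x) (a j x) (a k x * rf ε a τ k x * pf (a i x) * pf (a j x))
      (a i x * rf ε a τ i x * pf (a k x) * pf (a j x))
      (a j x * rf ε a τ j x * pf (a k x) * pf (a i x)) c (Sf K a x) = 0 := by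
  obtain ⟨drk, hdr, hdr'⟩ := s.dr_self hx h1 h2 h3
  obtain ⟨dS, hdS, hdS'⟩ := s.dS hx h1 h2 h3
  have hzk : PD (zf ε a τ k) k x _ :=
    ((PD.of_smooth s.hW (smooth_pd s.hW (s.st k) k) hx k).cmul (ε k)).div
      (s.da' x hx k i j h3.symm h1 h2.symm) (s.ne x hx k)
  refine Lpure (a k x) (a i x) (a j x) (τ k x) (zf ε a τ i x) (zf ε a τ j x) (zf ε a τ k x)
    (rf ε a τ i x) (rf ε a τ j x) (rf ε a τ k x) c (Sf K a x) _ drk dS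
    (s.sum' hx h3.symm h1 h2.symm) ht (s.pne x hx i) (s.pne x hx j)
    (s.Dne' hx h3.symm h1 h2.symm) (s.gauss x hx i j k h1 h2 h3)
    (s.gauss x hx i k j h3 h2.symm h1) (s.gauss x hx j k i h2 h3.symm h1.symm) hdr' hdS'
    (PD.eq_zero s.hW hx (fun y hy => s.gauss y hy i k j h3 h2.symm h1)
      (PD_EQ (s.da x hx k i h3.symm) (s.da' x hx k i j h3.symm h1 h2.symm) (s.da x hx k j h2.symm)
        (s.dz hx h1 h2 h3) hzk (s.dr hx h1 h2 h3) hdr (s.dr hx h1.symm h3 h2) hdS))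
    (PD.eq_zero s.hW hx (fun y hy => s.gauss y hy j k i h2 h3.symm h1.symm)
      (PD_EQ (s.da x hx k j h2.symm) (s.da' x hx k i j h3.symm h1 h2.symm) (s.da x hx k i h3.symm)
        (s.dz hx h1.symm h3 h2) hzk (s.dr hx h1.symm h3 h2) hdr (s.dr hx h1 h2 h3) hdS))

end Sys

lemma open_ne {W : Set E3} (hW : IsOpen W) {f : E3 → ℝ} (hf : ContDiffOn ℝ (⊤ : ℕ∞) f W) :
    IsOpen (W ∩ {y | f y ≠ 0}) :=
  hf.continuousOn.isOpen_inter_preimage hW isOpen_ne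

/-- identity theorem through a submersion -/
lemma subm_zero {G : Type*} [NormedAddCommGroup G] [NormedSpace ℝ G] [FiniteDimensional ℝ G]
    {W : Set E3} (hW : IsOpen W)
    {φ : E3 → G} (hφ : ContDiffOn ℝ (⊤ : ℕ∞) φ W) {x : E3} (hx : x ∈ W)
    (hs : Function.Surjective (fderiv ℝ φ x)) {F : G → ℝ} (hF : AnalyticOnNhd ℝ F Set.univ)
    (h0 : ∀ y ∈ W, F (φ y) = 0) (p : G) : F p = 0 := by
  have h1 : HasStrictFDerivAt φ (fderiv ℝ φ x) x :=
    (hφ.contDiffAt (hW.mem_nhds hx)).hasStrictFDerivAt (by simp)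
  have h2 := h1.map_nhds_eq_of_surj (LinearMap.range_eq_top.2 hs)
  have h3 : ∀ᶠ q in nhds (φ x), F q = 0 := by
    rw [← h2, Filter.eventually_map]
    filter_upwards [hW.mem_nhds hx] with y hy
    exact h0 y hy
  have h4 := hF.eq_of_eventuallyEq (g := fun _ => 0) (fun _ _ => analyticAt_const) h3
  exact congrFun h4 p

lemma PD.fderiv_eq {f : E3 → ℝ} {W : Set E3} (hW : IsOpen W)
    (hf : ContDiffOn ℝ (⊤ : ℕ∞) f W) {x : E3} (hx : x ∈ W) {j : Fin 3} {d : ℝ} (h : PD f j x d) :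
    fderiv ℝ f x (Pi.single j 1) = d := (PD.of_smooth hW hf hx j).unique h

lemma subm1 {W : Set E3} (hW : IsOpen W) {f : E3 → ℝ} (hf : ContDiffOn ℝ (⊤ : ℕ∞) f W) {x : E3}
    (hx : x ∈ W) {i : Fin 3} {d : ℝ} (hd : PD f i x d) (h : d ≠ 0) {F : ℝ → ℝ}
    (hF : AnalyticOnNhd ℝ F Set.univ) (h0 : ∀ y ∈ W, F (f y) = 0) (p : ℝ) : F p = 0 := by
  refine subm_zero hW hf hx (fun r => ⟨(r / d) • (Pi.single i 1 : E3), ?_⟩) hF h0 p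
  rw [map_smul, hd.fderiv_eq hW hf hx, smul_eq_mul]
  field_simp

lemma subm2 {W : Set E3} (hW : IsOpen W) {f g : E3 → ℝ} (hf : ContDiffOn ℝ (⊤ : ℕ∞) f W)
    (hg : ContDiffOn ℝ (⊤ : ℕ∞) g W) {x : E3}
    (hx : x ∈ W) {i j : Fin 3} {d1 d2 e1 e2 : ℝ} (hd1 : PD f i x d1) (hd2 : PD f j x d2)
    (he1 : PD g i x e1) (he2 : PD g j x e2) (h : d1 * e2 - d2 * e1 ≠ 0) {F : ℝ × ℝ → ℝ}
    (hF : AnalyticOnNhd ℝ F Set.univ) (h0 : ∀ y ∈ W, F (f y, g y) = 0) (p : ℝ × ℝ) : F p = 0 := by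
  refine subm_zero hW (hf.prodMk hg) hx (fun r => ?_) hF h0 p
  have hdf : DifferentiableAt ℝ f x := (hf.contDiffAt (hW.mem_nhds hx)).differentiableAt (by simp)
  have hdg : DifferentiableAt ℝ g x := (hg.contDiffAt (hW.mem_nhds hx)).differentiableAt (by simp)
  refine ⟨((r.1 * e2 - r.2 * d2) / (d1 * e2 - d2 * e1)) • (Pi.single i 1 : E3)
    + ((r.2 * d1 - r.1 * e1) / (d1 * e2 - d2 * e1)) • (Pi.single j 1 : E3), ?_⟩
  rw [hdf.fderiv_prodMk hdg]
  ext
  · simp only [ContinuousLinearMap.prod_apply, map_add, map_smul, Prod.fst_add,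
      Prod.smul_fst, hd1.fderiv_eq hW hf hx,
      hd2.fderiv_eq hW hf hx, smul_eq_mul]
    rw [div_mul_eq_mul_div, div_mul_eq_mul_div, ← add_div, div_eq_iff h]
    ring
  · simp only [ContinuousLinearMap.prod_apply, map_add, map_smul, Prod.snd_add,
      Prod.smul_snd, he1.fderiv_eq hW hg hx,
      he2.fderiv_eq hW hg hx, smul_eq_mul]
    rw [div_mul_eq_mul_div, div_mul_eq_mul_div, ← add_div, div_eq_iff h]
    ring

lemma pf_ne {t : ℝ} (h : pf t ≠ 0) : 3 * t - 1 ≠ 0 ∧ 1 - t ≠ 0 := by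
  unfold pf at h
  exact ⟨left_ne_zero_of_mul h, right_ne_zero_of_mul h⟩

/-! polynomials of the two-parameter case -/
noncomputable def m1c (x y : ℝ) : ℝ := 18*x^2+30*x*y-22*x-6*y+4
noncomputable def Mcc (x y : ℝ) : ℝ := -6*x*y-2*x-2*y+2
noncomputable def MSc (x y : ℝ) : ℝ :=
  30*x^3*y-2*x^3+48*x^2*y^2-52*x^2*y+4*x^2+30*x*y^3-52*x*y^2+28*x*y-2*x-2*y^3+4*y^2-2*y

noncomputable def detC (x y z u1 u2 u3 : ℝ) : ℝ :=
  ((pf y * Bc y x) * m1c y x - ((x - z) * Ac y x) * m1c x y) * u1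
  - (((y - z) * Ac x y) * m1c y x - (pf x * Bc x y) * m1c x y) * u2
  + (((y - z) * Ac x y) * ((x - z) * Ac y x) - (pf x * Bc x y) * (pf y * Bc y x)) * u3

noncomputable def FC (c K x y : ℝ) : ℝ :=
  c * DD x y (1 - x - y) * detC x y (1 - x - y) ((y - (1 - x - y)) * Cc x y)
    ((x - (1 - x - y)) * Cc y x) (Mcc x y)
  + K * detC x y (1 - x - y) ((y - (1 - x - y)) * Sc x y) ((x - (1 - x - y)) * Sc y x) (MSc x y)

lemma FC_pure (x y z R1 R2 c S K : ℝ) (hs : x + y + z = 1) (hS : S * DD x y z = K)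
    (h1 : Lr x y z R1 R2 0 c S = 0) (h2 : Lr y x z R2 R1 0 c S = 0)
    (h3 : m1c x y * R1 + m1c y x * R2 + Mcc x y * c + MSc x y * S = 0) : FC c K x y = 0 := by
  obtain rfl : z = 1 - x - y := by linarith
  unfold FC
  unfold Lr at h1 h2
  linear_combination (norm := (unfold detC; ring1)) DD x y (1 - x - y) * (
    ((pf y * Bc y x) * m1c y x - ((x - (1 - x - y)) * Ac y x) * m1c x y) * h1
    - (((y - (1 - x - y)) * Ac x y) * m1c y x - (pf x * Bc x y) * m1c x y) * h2
    + (((y - (1 - x - y)) * Ac x y) * ((x - (1 - x - y)) * Ac y x)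
      - (pf x * Bc x y) * (pf y * Bc y x)) * h3)
    - detC x y (1 - x - y) ((y - (1 - x - y)) * Sc x y) ((x - (1 - x - y)) * Sc y x) (MSc x y) * hS

lemma M_pure (x y z zi zj ri rj c S : ℝ) (hs : x + y + z = 1)
    (h1 : EQ x y z zi zj ri rj 0 c S = 0) (h2 : EQ x z y zi 0 ri 0 rj c S = 0)
    (h3 : EQ y z x zj 0 rj 0 ri c S = 0) :
    m1c x y * (x * ri * pf y * pf z) + m1c y x * (y * rj * pf x * pf z)
      + Mcc x y * c + MSc x y * S = 0 := by
  obtain rfl : z = 1 - x - y := by linarith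
  unfold EQ pf at h1 h2 h3
  unfold m1c Mcc MSc pf
  linear_combination (norm := (unfold pf; ring1)) pf (1 - x - y) * h1 - pf y * h2 - pf x * h3

lemma FC_analytic (c K : ℝ) : AnalyticOnNhd ℝ (fun p : ℝ × ℝ => FC c K p.1 p.2) Set.univ := by
  rw [← contDiff_omega_iff_analyticOnNhd]
  unfold FC detC DD m1c Mcc MSc Ac Bc Cc Sc pf
  fun_prop

lemma FC_final (c K : ℝ) (h1 : FC c K 2 0 = 0) (h2 : FC c K (-1) 0 = 0) : K = 0 := by
  unfold FC detC DD m1c Mcc MSc Ac Bc Cc Sc pf at h1 h2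
  norm_num at h1 h2
  linarith

/-! polynomials of the one-parameter case -/
noncomputable def AB (c K x : ℝ) : ℝ := c * (1 - 9*x) * x * (1 - x) + K * (18*x^3 - 14*x^2 + 3*x)
noncomputable def BB (c K x : ℝ) : ℝ := c * (1 - 9*x)^2 - K
noncomputable def AB' (c K x : ℝ) : ℝ := c * (1 - 20*x + 27*x^2) + K * (54*x^2 - 28*x + 3)
noncomputable def BB' (c x : ℝ) : ℝ := -18 * c * (1 - 9*x)
noncomputable def G0 (x : ℝ) : ℝ := -3*(1-x)^3 + 4*(1-x)^2 - (1-x)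
noncomputable def G1 (x : ℝ) : ℝ := 9*(1-x) - 8
noncomputable def P0 (x : ℝ) : ℝ := -3*(1-x)^2 + 4*(1-x) - 2
noncomputable def RB (c K x : ℝ) : ℝ :=
  -(AB' c K x * BB c K x - BB' c x * AB c K x) * (G0 x * BB c K x - G1 x * AB c K x)
    - AB c K x * BB c K x * (P0 x * BB c K x - 6 * AB c K x)

lemma B_pure (x y z zi ri c S K : ℝ) (hs : x + y + z = 1) (hne : y ≠ z) (hS : S * DD x y z = K)
    (h1 : EQ y z x 0 0 0 0 ri c S = 0) (h2 : EQ x y z zi 0 ri 0 0 c S = 0)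
    (h3 : EQ x z y zi 0 ri 0 0 c S = 0) : AB c K x + BB c K x * (y * z) = 0 := by
  have key : (y - z) * (c * (1 - 9 * x) + S * (18 * x^3 - 14 * x^2 + 3 * x - y * z)) = 0 := by
    obtain rfl : z = 1 - x - y := by linarith
    unfold EQ pf at h1 h2 h3
    linear_combination (norm := (unfold pf; ring1)) (-1 / 2) * ((y - (1 - x - y)) * (15 * x - 3) * h1
      - (pf (1 - x - y) * h2 - pf y * h3))
  have k2 := (mul_eq_zero.mp key).resolve_left (sub_ne_zero.2 hne)
  have hD : DD x y z = x * (1 - x) + y * z * (1 - 9 * x) := by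
    obtain rfl : z = 1 - x - y := by linarith
    unfold DD pf; ring
  rw [hD] at hS
  unfold AB BB
  linear_combination (x * (1 - x) + y * z * (1 - 9 * x)) * k2 
    - (18 * x^3 - 14 * x^2 + 3 * x - y * z) * hS

lemma RB_pure (x y z c K : ℝ) (hs : x + y + z = 1) (h1 : AB c K x + BB c K x * (y * z) = 0)
    (h2 : -(AB' c K x + BB' c x * (y * z)) * (y * pf y + z * pf z)
      + BB c K x * (y * z) * (pf y + pf z) = 0) : RB c K x = 0 := by
  have hg : y * pf y + z * pf z = G0 x + y * z * G1 x := by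
    obtain rfl : z = 1 - x - y := by linarith
    unfold G0 G1 pf; ring
  have hp : pf y + pf z = P0 x + 6 * (y * z) := by
    obtain rfl : z = 1 - x - y := by linarith
    unfold P0 pf; ring
  rw [hg, hp] at h2
  unfold RB
  generalize AB c K x = A, BB c K x = B, AB' c K x = A', BB' c x = B', G0 x = g0, G1 x = g1,
    P0 x = p0 at *
  linear_combination B ^ 2 * h2 - h1 * ((-(A' * B * g1 + B' * g0 * B) + p0 * B ^ 2)
    + (-B' * g1 + 6 * B) * (B * (y * z) - A))

lemma RB_analytic (c K : ℝ) : AnalyticOnNhd ℝ (fun x : ℝ => RB c K x) Set.univ := by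
  rw [← contDiff_omega_iff_analyticOnNhd]
  unfold RB AB BB AB' BB' G0 G1 P0
  fun_prop

lemma RB_final (c K : ℝ) (hK : K ≠ 0) (h1 : RB c K (1 / 9) = 0) : c = K := by
  unfold RB AB BB AB' BB' G0 G1 P0 at h1
  have h2 : K ^ 2 * (c - K) = 0 := by linear_combination (2187 / 320) * h1
  have := (mul_eq_zero.mp h2).resolve_left (pow_ne_zero 2 hK)
  linarith

lemma AB_deriv (c K x : ℝ) : HasDerivAt (AB c K) (AB' c K x) x := by
  have h : HasDerivAt (fun t : ℝ => (9 * c + 18 * K) * t ^ 3 + (-10 * c - 14 * K) * t ^ 2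
      + (c + 3 * K) * t) _ x :=
    (((hasDerivAt_pow 3 x).const_mul (9 * c + 18 * K)).fun_add
      ((hasDerivAt_pow 2 x).const_mul (-10 * c - 14 * K))).fun_add
      ((hasDerivAt_id' x).const_mul (c + 3 * K))
  have e : AB c K = fun t : ℝ => (9 * c + 18 * K) * t ^ 3 + (-10 * c - 14 * K) * t ^ 2
      + (c + 3 * K) * t := by funext t; unfold AB; ring
  rw [e]
  refine h.congr_deriv ?_
  unfold AB'
  push_cast
  ring

lemma BB_deriv (c K x : ℝ) : HasDerivAt (BB c K) (BB' c x) x := by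
  have h : HasDerivAt (fun t : ℝ => (81 * c) * t ^ 2 + (-18 * c) * t + (c - K)) _ x :=
    (((hasDerivAt_pow 2 x).const_mul (81 * c)).fun_add
      ((hasDerivAt_id' x).const_mul (-18 * c))).add_const (c - K)
  have e : BB c K = fun t : ℝ => (81 * c) * t ^ 2 + (-18 * c) * t + (c - K) := by
    funext t; unfold BB; ring
  rw [e]
  refine h.congr_deriv ?_
  unfold BB'
  push_cast
  ring

namespace Sys

variable {W : Set E3} {c K : ℝ} {ε : Fin 3 → ℝ} {a τ : Fin 3 → E3 → ℝ}

lemma zr_zero (s : Sys W c K ε a τ) {k : Fin 3} (h : ∀ y ∈ W, τ k y = 0) {x : E3} (hx : x ∈ W) :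
    zf ε a τ k x = 0 ∧ rf ε a τ k x = 0 := by
  have h1 := PD.eq_zero s.hW hx h (s.t_self hx k)
  constructor
  · unfold zf; rw [h1]; simp
  · unfold rf; rw [h x hx]; simp

lemma caseA (s : Sys W c K ε a τ) (h : ∀ i, ∀ y ∈ W, τ i y = 0) {x : E3} (hx : x ∈ W) : False := by
  have g1 := s.gauss x hx 0 1 2 (by decide) (by decide) (by decide)
  have g2 := s.gauss x hx 0 2 1 (by decide) (by decide) (by decide)
  simp only [(s.zr_zero (h _) hx).1, (s.zr_zero (h _) hx).2] at g1 g2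
  unfold EQ at g1 g2
  have hs := s.sum x hx
  have h3 : Sf K a x * ((a 1 x - a 2 x) * (3 * a 0 x - 1)) = 0 := by
    linear_combination g2 - g1 + Sf K a x * (a 1 x - a 2 x) * hs
  rcases mul_eq_zero.mp h3 with h4 | h4
  · exact s.S_ne hx h4
  rcases mul_eq_zero.mp h4 with h4 | h4
  · exact s.dne x hx 1 2 (by decide) (by linarith)
  · exact (pf_ne (s.pne x hx 0)).1 h4

lemma caseD (s : Sys W c K ε a τ) (ht : ∀ i, ∀ y ∈ W, τ i y ≠ 0) {x : E3} (hx : x ∈ W) :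
    False := by
  have hB : ∀ y ∈ W, (1 - a 0 y) * (1 - a 1 y) * (1 - a 2 y) = 4 / 15 := by
    intro y hy
    have e1 := s.Lk hy (i := 1) (j := 2) (k := 0) (by decide) (by decide) (by decide) (ht 0 y hy)
    have e2 := s.Lk hy (i := 2) (j := 0) (k := 1) (by decide) (by decide) (by decide) (ht 1 y hy)
    have e3 := s.Lk hy (i := 0) (j := 1) (k := 2) (by decide) (by decide) (by decide) (ht 2 y hy)
    have hc := Lr_comb (a 0 y) (a 1 y) (a 2 y) (a 0 y * rf ε a τ 0 y * pf (a 1 y) * pf (a 2 y))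
      (a 1 y * rf ε a τ 1 y * pf (a 0 y) * pf (a 2 y))
      (a 2 y * rf ε a τ 2 y * pf (a 0 y) * pf (a 1 y)) c (Sf K a y) (s.sum y hy)
    have e2' : Lr (a 1 y) (a 2 y) (a 0 y) (a 1 y * rf ε a τ 1 y * pf (a 0 y) * pf (a 2 y))
      (a 2 y * rf ε a τ 2 y * pf (a 0 y) * pf (a 1 y))
      (a 0 y * rf ε a τ 0 y * pf (a 1 y) * pf (a 2 y)) c (Sf K a y) = 0 :=
      Eq.trans (by congr 1 <;> ring) e2
    have e3' : Lr (a 2 y) (a 0 y) (a 1 y) (a 2 y * rf ε a τ 2 y * pf (a 0 y) * pf (a 1 y))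
      (a 0 y * rf ε a τ 0 y * pf (a 1 y) * pf (a 2 y))
      (a 1 y * rf ε a τ 1 y * pf (a 0 y) * pf (a 2 y)) c (Sf K a y) = 0 :=
      Eq.trans (by congr 1 <;> ring) e3
    rw [e1, e2', e3'] at hc
    have n0 := (pf_ne (s.pne y hy 0)).1
    have n1 := (pf_ne (s.pne y hy 1)).1
    have n2 := (pf_ne (s.pne y hy 2)).1
    have d0 := sub_ne_zero.2 (s.dne y hy 0 1 (by decide))
    have d1 := sub_ne_zero.2 (s.dne y hy 1 2 (by decide))
    have d2 := sub_ne_zero.2 (s.dne y hy 2 0 (by decide))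
    have hS := s.S_ne hy
    have hq : Sf K a y * ((3 * a 0 y - 1) * (3 * a 1 y - 1) * (3 * a 2 y - 1) *
        ((a 0 y - a 1 y) * (a 1 y - a 2 y) * (a 2 y - a 0 y))) ≠ 0 := by
      simp only [ne_eq, mul_eq_zero, not_or]; tauto
    have : 30 * ((1 - a 0 y) * (1 - a 1 y) * (1 - a 2 y)) - 8 = 0 := by
      apply (mul_eq_zero.mp (?_ : Sf K a y * ((3 * a 0 y - 1) * (3 * a 1 y - 1) * (3 * a 2 y - 1) *
        ((a 0 y - a 1 y) * (a 1 y - a 2 y) * (a 2 y - a 0 y))) * _ = 0)).resolve_left hq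
      linear_combination hc
    linarith
  have one : ∀ l, ∀ d0 d1 d2 : ℝ, PD (a 0) l x d0 → PD (a 1) l x d1 → PD (a 2) l x d2 →
      d0 * (1 - a 1 x) * (1 - a 2 x) + d1 * (1 - a 0 x) * (1 - a 2 x)
        + d2 * (1 - a 0 x) * (1 - a 1 x) = 0 := by
    intro l d0 d1 d2 h0 h1 h2
    have := PD.eq_zero s.hW hx hB ((((PD.const 1 l x).sub h0).mul ((PD.const 1 l x).sub h1)).mul
      ((PD.const 1 l x).sub h2))
    linear_combination -this
  have q0 := one 0 _ _ _ (s.da' x hx 0 1 2 (by decide) (by decide) (by decide))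
    (s.da x hx 0 1 (by decide)) (s.da x hx 0 2 (by decide))
  have q1 := one 1 _ _ _ (s.da x hx 1 0 (by decide))
    (s.da' x hx 1 0 2 (by decide) (by decide) (by decide)) (s.da x hx 1 2 (by decide))
  have hf : τ 0 x * τ 1 x * (DD (a 0 x) (a 1 x) (a 2 x) * ((1 - a 2 x) * (a 0 x - a 1 x))) = 0 := by
    unfold DD
    linear_combination (-1 / 2) * τ 1 x * q0 + (1 / 2) * τ 0 x * q1
  have n2 := (pf_ne (s.pne x hx 2)).2
  have d0 := sub_ne_zero.2 (s.dne x hx 0 1 (by decide))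
  exact mul_ne_zero (mul_ne_zero (ht 0 x hx) (ht 1 x hx))
    (mul_ne_zero (s.Dne x hx) (mul_ne_zero n2 d0)) hf

lemma caseC (s : Sys W c K ε a τ) {i j k : Fin 3} (h1 : i ≠ j) (h2 : j ≠ k) (h3 : i ≠ k)
    (hi : ∀ y ∈ W, τ i y ≠ 0) (hj : ∀ y ∈ W, τ j y ≠ 0) (hk : ∀ y ∈ W, τ k y = 0)
    {x : E3} (hx : x ∈ W) : False := by
  have hF : ∀ y ∈ W, FC c K (a i y) (a j y) = 0 := by
    intro y hy
    obtain ⟨hz, hr⟩ := s.zr_zero hk hy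
    have e1 := s.Lk hy h2 h3.symm h1.symm (hi y hy)
    have e2 := s.Lk hy h3 h2.symm h1 (hj y hy)
    have g1 := s.gauss y hy i j k h1 h2 h3
    have g2 := s.gauss y hy i k j h3 h2.symm h1
    have g3 := s.gauss y hy j k i h2 h3.symm h1.symm
    rw [hr] at e1 e2 g1
    rw [hz, hr] at g2 g3
    have hM := M_pure _ _ _ _ _ _ _ _ _ (s.sum' hy h1 h2 h3) g1 g2 g3
    refine FC_pure _ _ _ (a i y * rf ε a τ i y * pf (a j y) * pf (a k y))
      (a j y * rf ε a τ j y * pf (a i y) * pf (a k y)) c _ K (s.sum' hy h1 h2 h3)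
      (s.S_eq hy h1 h2 h3) ?_ ?_ hM
    · exact Eq.trans (by congr 1 <;> ring) e1
    · exact Eq.trans (by congr 1 <;> ring) e2
  have hall : ∀ p : ℝ × ℝ, FC c K p.1 p.2 = 0 := by
    refine subm2 s.hW (s.sa i) (s.sa j) hx (s.da' x hx i j k h1 h2 h3) (s.da x hx j i h1.symm)
      (s.da x hx i j h1) (s.da' x hx j i k h1.symm h3 h2) ?_ (FC_analytic c K) hF
    have hne : 4 * (τ i x * τ j x * (a k x * pf (a k x)) * DD (a i x) (a j x) (a k x)) ≠ 0 :=
      mul_ne_zero (by norm_num) (mul_ne_zero (mul_ne_zero (mul_ne_zero (hi x hx) (hj x hx))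
        (mul_ne_zero (s.ne x hx k) (s.pne x hx k))) (s.Dne' hx h1 h2 h3))
    convert hne using 1
    unfold DD
    ring
  exact s.hK (FC_final c K (hall (2, 0)) (hall (-1, 0)))

lemma caseB (s : Sys W c K ε a τ) {i j k : Fin 3} (h1 : i ≠ j) (h2 : j ≠ k) (h3 : i ≠ k)
    (hi : ∀ y ∈ W, τ i y ≠ 0) (hj : ∀ y ∈ W, τ j y = 0) (hk : ∀ y ∈ W, τ k y = 0)
    {x₀ : E3} (hx₀ : x₀ ∈ W) : False := by
  -- a point where `a i` is not critical
  obtain ⟨x, hx, hgx⟩ : ∃ x ∈ W, a j x * pf (a j x) + a k x * pf (a k x) ≠ 0 := by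
    by_contra! hcon
    have q := PD.eq_zero s.hW hx₀ hcon (((s.da x₀ hx₀ i j h1).mul (s.da x₀ hx₀ i j h1).pf).add
      ((s.da x₀ hx₀ i k h3).mul (s.da x₀ hx₀ i k h3).pf))
    have q0 := hcon x₀ hx₀
    have q1 : τ i x₀ * ((a j x₀ * pf (a j x₀)) * ((a j x₀ - a k x₀) *
        (8 - 9 * (a j x₀ + a k x₀)))) = 0 := by
      linear_combination (norm := (unfold pf; ring1)) (1 / 2) * q
        - τ i x₀ * (-9 * a k x₀ ^ 2 + 8 * a k x₀ - 1) * q0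
    have q2 : 8 - 9 * (a j x₀ + a k x₀) = 0 := by
      have := (mul_eq_zero.mp q1).resolve_left (hi x₀ hx₀)
      have := (mul_eq_zero.mp this).resolve_left (mul_ne_zero (s.ne x₀ hx₀ j) (s.pne x₀ hx₀ j))
      exact (mul_eq_zero.mp this).resolve_left (sub_ne_zero.2 (s.dne x₀ hx₀ j k h2))
    have q3 : a k x₀ = 8 / 9 - a j x₀ := by linarith
    rw [q3] at q0
    unfold pf at q0
    ring_nf at q0
    norm_num at q0
  have hP : ∀ y ∈ W, AB c K (a i y) + BB c K (a i y) * (a j y * a k y) = 0 := by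
    intro y hy
    obtain ⟨hz, hr⟩ := s.zr_zero hk hy
    obtain ⟨hz', hr'⟩ := s.zr_zero hj hy
    have g1 := s.gauss y hy i j k h1 h2 h3
    have g2 := s.gauss y hy i k j h3 h2.symm h1
    have g3 := s.gauss y hy j k i h2 h3.symm h1.symm
    simp only [hr, hr', hz, hz'] at g1 g2 g3
    exact B_pure _ _ _ _ _ _ _ _ (s.sum' hy h1 h2 h3) (s.dne y hy j k h2)
      (s.S_eq hy h1 h2 h3) g3 g1 g2
  have hR : ∀ y ∈ W, RB c K (a i y) = 0 := by
    intro y hy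
    refine RB_pure _ _ _ _ _ (s.sum' hy h1 h2 h3) (hP y hy) ?_
    have pa := s.da' y hy i j k h1 h2 h3
    have q := PD.eq_zero s.hW hy hP ((pa.comp (AB_deriv c K _)).add
      ((pa.comp (BB_deriv c K _)).mul ((s.da y hy i j h1).mul (s.da y hy i k h3))))
    apply mul_left_cancel₀ (hi y hy)
    linear_combination (1 / 2) * q
  have hda : -2 * τ i x * (a j x * pf (a j x) + a k x * pf (a k x)) ≠ 0 :=
    mul_ne_zero (mul_ne_zero (by norm_num) (hi x hx)) hgx
  have hall := subm1 s.hW (s.sa i) hx (s.da' x hx i j k h1 h2 h3) hda (RB_analytic c K) hR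
  have hcK := RB_final c K s.hK (hall (1 / 9))
  subst hcK
  have hconst : ∀ y ∈ W, a i y = 2 / 9 := by
    intro y hy
    have hp := hP y hy
    have hs := s.sum' hy h1 h2 h3
    have e : c * (a i y * ((9 * a i y - 2) * ((3 * a j y - 1) * (3 * a k y - 1)))) = 0 := by
      have hs' : a k y = 1 - a i y - a j y := by linarith
      rw [hs'] at hp ⊢
      unfold AB BB at hp
      linear_combination hp
    have e1 := (mul_eq_zero.mp e).resolve_left s.hK
    have e2 := (mul_eq_zero.mp e1).resolve_left (s.ne y hy i)
    have e3 := (mul_eq_zero.mp e2).resolve_right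
      (mul_ne_zero (pf_ne (s.pne y hy j)).1 (pf_ne (s.pne y hy k)).1)
    linarith
  exact hda (PD.eq_zero s.hW hx hconst (s.da' x hx i j k h1 h2 h3))

lemma third : ∀ i j : Fin 3, i ≠ j → ∃ k, j ≠ k ∧ i ≠ k := by decide

lemma forall3 {P : Fin 3 → Prop} {i j k : Fin 3} (h1 : i ≠ j) (h2 : j ≠ k) (h3 : i ≠ k)
    (hi : P i) (hj : P j) (hk : P k) : ∀ l, P l := by
  have : ∀ i j k l : Fin 3, i ≠ j → j ≠ k → i ≠ k → l = i ∨ l = j ∨ l = k := by decide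
  intro l
  rcases this i j k l h1 h2 h3 with rfl | rfl | rfl <;> assumption

lemma restrict (s : Sys W c K ε a τ) (i : Fin 3) : Sys (W ∩ {y | τ i y ≠ 0}) c K ε a τ :=
  s.mono (open_ne s.hW (s.st i)) Set.inter_subset_left

lemma contra2 (s : Sys W c K ε a τ) {i j : Fin 3} (h1 : i ≠ j)
    (hi : ∀ y ∈ W, τ i y ≠ 0) (hj : ∀ y ∈ W, τ j y ≠ 0) {x : E3} (hx : x ∈ W) : False := by
  obtain ⟨k, h2, h3⟩ := third i j h1
  by_cases hk : ∀ y ∈ W, τ k y = 0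
  · exact s.caseC h1 h2 h3 hi hj hk hx
  · push Not at hk
    obtain ⟨y, hy, hky⟩ := hk
    exact (s.restrict k).caseD (forall3 (P := fun l => ∀ y ∈ W ∩ {y | τ k y ≠ 0}, τ l y ≠ 0)
      h1 h2 h3 (fun z hz => hi z hz.1) (fun z hz => hj z hz.1) (fun z hz => hz.2)) ⟨hy, hky⟩

lemma contra1 (s : Sys W c K ε a τ) {i : Fin 3}
    (hi : ∀ y ∈ W, τ i y ≠ 0) {x : E3} (hx : x ∈ W) : False := by
  by_cases h : ∃ j, i ≠ j ∧ ∃ y ∈ W, τ j y ≠ 0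
  · obtain ⟨j, hij, y, hy, hjy⟩ := h
    exact (s.restrict j).contra2 hij (fun z hz => hi z hz.1) (fun z hz => hz.2) ⟨hy, hjy⟩
  · push Not at h
    have : ∀ i : Fin 3, ∃ j k, i ≠ j ∧ j ≠ k ∧ i ≠ k := by decide
    obtain ⟨j, k, h1, h2, h3⟩ := this i
    exact s.caseB h1 h2 h3 hi (h j h1) (h k h3) hx

lemma contra (s : Sys W c K ε a τ) {x : E3} (hx : x ∈ W) : False := by
  by_cases h : ∃ j, ∃ y ∈ W, τ j y ≠ 0
  · obtain ⟨j, y, hy, hjy⟩ := h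
    exact (s.restrict j).contra1 (fun z hz => hz.2) ⟨hy, hjy⟩
  · push Not at h
    exact s.caseA h hx

end Sys

lemma delta_sq (i : Fin 3) : delta i ^ 2 = 1 := by
  unfold delta; fin_cases i <;> norm_num

lemma delta_ne (i : Fin 3) : delta i ≠ 0 := by
  intro h; have := delta_sq i; rw [h] at this; norm_num at this

noncomputable def af (v : Fin 3 → E3 → ℝ) (i : Fin 3) (x : E3) : ℝ := delta i * v i x ^ 2

/-- the original system in terms of `PD` -/
structure Orig (W : Set E3) (c K : ℝ) (v V : Fin 3 → E3 → ℝ) (h : Fin 3 → Fin 3 → E3 → ℝ) :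
    Prop where
  hW : IsOpen W
  hK : K ≠ 0
  sv : ∀ i, ContDiffOn ℝ (⊤ : ℕ∞) (v i) W
  sV : ∀ i, ContDiffOn ℝ (⊤ : ℕ∞) (V i) W
  sh : ∀ i j, i ≠ j → ContDiffOn ℝ (⊤ : ℕ∞) (h i j) W
  vpos : ∀ x ∈ W, ∀ i, 0 < v i x
  Vne : ∀ x ∈ W, ∀ i, V i x ≠ 0
  lne : ∀ x ∈ W, ∀ i j, i ≠ j → V i x / v i x ≠ V j x / v j x
  e1 : ∀ x ∈ W, af v 0 x + af v 1 x + af v 2 x = 1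
  e2 : ∀ x ∈ W, delta 0 * v 0 x * V 0 x + delta 1 * v 1 x * V 1 x + delta 2 * v 2 x * V 2 x = 0
  e3 : ∀ x ∈ W, delta 0 * V 0 x ^ 2 + delta 1 * V 1 x ^ 2 + delta 2 * V 2 x ^ 2 = K
  e4 : ∀ x ∈ W, V 0 x / v 0 x + V 1 x / v 1 x + V 2 x / v 2 x = 0
  dv : ∀ x ∈ W, ∀ i j, i ≠ j → PD (v j) i x (h i j x * v i x)
  dV : ∀ x ∈ W, ∀ i j, i ≠ j → PD (V j) i x (h i j x * V i x)
  dv' : ∀ x ∈ W, ∀ i j k, i ≠ j → j ≠ k → i ≠ k →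
    PD (v i) i x (-delta i * (delta j * h i j x * v j x + delta k * h i k x * v k x))
  dV' : ∀ x ∈ W, ∀ i j k, i ≠ j → j ≠ k → i ≠ k →
    PD (V i) i x (-delta i * (delta j * h i j x * V j x + delta k * h i k x * V k x))
  g2 : ∀ x ∈ W, ∀ i j k, i ≠ j → j ≠ k → i ≠ k → ∀ d e, PD (h i j) i x d → PD (h j i) j x e →
    d + e + h k i x * h k j x + V i x * V j x + c * (v i x * v j x) = 0
  g3 : ∀ x ∈ W, ∀ i j k, i ≠ j → j ≠ k → i ≠ k → PD (h i k) j x (h i j x * h j k x)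

lemma alg_param (x y z l m n K : ℝ) (h1 : x + y + z = 1) (h2 : x * l + y * m + z * n = 0)
    (h3 : l + m + n = 0) (h4 : x * l ^ 2 + y * m ^ 2 + z * n ^ 2 = K) (hl : l ≠ 0)
    (hne : ¬ (x = y ∧ y = z)) :
    ∃ s, l = s * (y - z) ∧ m = s * (z - x) ∧ n = s * (x - y) ∧ s ^ 2 * DD x y z = K := by
  have hn : n = -l - m := by linarith
  subst hn
  have e : l * (x - z) + m * (y - z) = 0 := by linear_combination h2
  have hyz : y - z ≠ 0 := by
    intro h0
    rw [h0] at e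
    have : x - z = 0 := by
      apply (mul_eq_zero.mp (?_ : l * (x - z) = 0)).resolve_left hl
      linarith
    exact hne ⟨by linarith, by linarith⟩
  obtain ⟨s, rfl⟩ : ∃ s, l = s * (y - z) := ⟨l / (y - z), by field_simp⟩
  obtain rfl : m = s * (z - x) := by
    apply mul_right_cancel₀ hyz
    linear_combination e
  refine ⟨s, rfl, rfl, by ring, ?_⟩
  rw [← h4]
  obtain rfl : z = 1 - x - y := by linarith
  unfold DD pf
  ring

lemma R_pure (ti tj tk vi vj vk s hij hik : ℝ) (hti : ti ^ 2 = 1) (hs : s ≠ 0)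
    (hsum : ti * vi ^ 2 + tj * vj ^ 2 + tk * vk ^ 2 = 1)
    (q : (-ti * (tj * hij * (s * (tk * vk ^ 2 - ti * vi ^ 2) * vj)
          + tk * hik * (s * (ti * vi ^ 2 - tj * vj ^ 2) * vk))) * vj * vk
        + (s * (tj * vj ^ 2 - tk * vk ^ 2) * vi) * (hij * vi * vk + vj * (hik * vi))
        + hij * (s * (tj * vj ^ 2 - tk * vk ^ 2) * vi) * vi * vk
        + (s * (tk * vk ^ 2 - ti * vi ^ 2) * vj) *
          (-ti * (tj * hij * vj + tk * hik * vk) * vk + vi * (hik * vi))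
        + hik * (s * (tj * vj ^ 2 - tk * vk ^ 2) * vi) * vi * vj
        + (s * (ti * vi ^ 2 - tj * vj ^ 2) * vk) *
          (-ti * (tj * hij * vj + tk * hik * vk) * vj + vi * (hij * vi)) = 0) :
    hij * vk * pf (tk * vk ^ 2) = hik * vj * pf (tj * vj ^ 2) := by
  have ht : ti ≠ 0 := by rintro rfl; norm_num at hti
  apply mul_left_cancel₀ (mul_ne_zero hs ht)
  unfold pf
  linear_combination -q
    + s * ti * (hij * vk * (ti * vi ^ 2 + tj * vj ^ 2 + tk * vk ^ 2 + 1 - 4 * (tk * vk ^ 2))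
      - hik * vj * (ti * vi ^ 2 + tj * vj ^ 2 + tk * vk ^ 2 + 1 - 4 * (tj * vj ^ 2))) * hsum
    - s * vi ^ 2 * (hij * vk * (ti * vi ^ 2 + tj * vj ^ 2 - 2 * (tk * vk ^ 2))
      - hik * vj * (ti * vi ^ 2 + tk * vk ^ 2 - 2 * (tj * vj ^ 2))) * hti

namespace Orig

variable {W : Set E3} {c K : ℝ} {v V : Fin 3 → E3 → ℝ} {h : Fin 3 → Fin 3 → E3 → ℝ}

lemma mono (s : Orig W c K v V h) {W' : Set E3} (ho : IsOpen W') (hs : W' ⊆ W) :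
    Orig W' c K v V h where
  hW := ho
  hK := s.hK
  sv i := (s.sv i).mono hs
  sV i := (s.sV i).mono hs
  sh i j hij := (s.sh i j hij).mono hs
  vpos x hx := s.vpos x (hs hx)
  Vne x hx := s.Vne x (hs hx)
  lne x hx := s.lne x (hs hx)
  e1 x hx := s.e1 x (hs hx)
  e2 x hx := s.e2 x (hs hx)
  e3 x hx := s.e3 x (hs hx)
  e4 x hx := s.e4 x (hs hx)
  dv x hx := s.dv x (hs hx)
  dV x hx := s.dV x (hs hx)
  dv' x hx := s.dv' x (hs hx)
  dV' x hx := s.dV' x (hs hx)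
  g2 x hx := s.g2 x (hs hx)
  g3 x hx := s.g3 x (hs hx)

lemma sum' (s : Orig W c K v V h) {x : E3} (hx : x ∈ W) {i j k : Fin 3} (h1 : i ≠ j) (h2 : j ≠ k)
    (h3 : i ≠ k) : af v i x + af v j x + af v k x = 1 :=
  (sum_perm (fun l => af v l x) h1 h2 h3).trans (s.e1 x hx)

lemma a_ne (s : Orig W c K v V h) {x : E3} (hx : x ∈ W) (i : Fin 3) : af v i x ≠ 0 :=
  mul_ne_zero (delta_ne i) (pow_ne_zero 2 (s.vpos x hx i).ne')

lemma param (s : Orig W c K v V h) {x : E3} (hx : x ∈ W) {i j k : Fin 3} (h1 : i ≠ j) (h2 : j ≠ k)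
    (h3 : i ≠ k) : ∃ r, V i x = r * (af v j x - af v k x) * v i x ∧
      V j x = r * (af v k x - af v i x) * v j x ∧ V k x = r * (af v i x - af v j x) * v k x ∧
      r ^ 2 * DD (af v i x) (af v j x) (af v k x) = K := by
  have vn : ∀ l, v l x ≠ 0 := fun l => (s.vpos x hx l).ne'
  have q2 : af v i x * (V i x / v i x) + af v j x * (V j x / v j x)
      + af v k x * (V k x / v k x) = 0 := by
    rw [sum_perm (fun l => af v l x * (V l x / v l x)) h1 h2 h3, ← s.e2 x hx]
    have := vn 0; have := vn 1; have := vn 2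
    simp only [af]
    field_simp
  have q3 : V i x / v i x + V j x / v j x + V k x / v k x = 0 := by
    rw [sum_perm (fun l => V l x / v l x) h1 h2 h3, s.e4 x hx]
  have q4 : af v i x * (V i x / v i x) ^ 2 + af v j x * (V j x / v j x) ^ 2
      + af v k x * (V k x / v k x) ^ 2 = K := by
    rw [sum_perm (fun l => af v l x * (V l x / v l x) ^ 2) h1 h2 h3, ← s.e3 x hx]
    have := vn 0; have := vn 1; have := vn 2
    simp only [af]
    field_simp
  have hne : ¬ (af v i x = af v j x ∧ af v j x = af v k x) := by
    rintro ⟨u1, u2⟩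
    have hall := Sys.forall3 (P := fun l => af v l x = af v i x) h1 h2 h3 rfl u1.symm (u1.trans u2).symm
    have hs := s.sum' hx h1 h2 h3
    have h0 := hall 1
    have hneg : af v 1 x < 0 := by
      have := s.vpos x hx 1
      simp [af, delta]
      positivity
    linarith
  obtain ⟨r, r1, r2, r3, r4⟩ := alg_param _ _ _ _ _ _ K (s.sum' hx h1 h2 h3) q2 q3 q4
    (div_ne_zero (s.Vne x hx i) (vn i)) hne
  exact ⟨r, (div_eq_iff (vn i)).1 r1, (div_eq_iff (vn j)).1 r2, (div_eq_iff (vn k)).1 r3, r4⟩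

lemma D_ne (s : Orig W c K v V h) {x : E3} (hx : x ∈ W) {i j k : Fin 3} (h1 : i ≠ j) (h2 : j ≠ k)
    (h3 : i ≠ k) : DD (af v i x) (af v j x) (af v k x) ≠ 0 := by
  obtain ⟨r, -, -, -, r4⟩ := s.param hx h1 h2 h3
  intro h0
  rw [h0, mul_zero] at r4
  exact s.hK r4.symm

lemma d_ne (s : Orig W c K v V h) {x : E3} (hx : x ∈ W) {i j : Fin 3} (h1 : i ≠ j) :
    af v i x ≠ af v j x := by
  obtain ⟨k, h2, h3⟩ := Sys.third i j h1
  obtain ⟨r, -, -, r3, -⟩ := s.param hx h1 h2 h3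
  intro h0
  rw [h0] at r3
  exact s.Vne x hx k (by rw [r3]; ring)

lemma a3_ne (s : Orig W c K v V h) {x : E3} (hx : x ∈ W) (k : Fin 3) : 3 * af v k x - 1 ≠ 0 := by
  have : ∀ k : Fin 3, ∃ i j, i ≠ j ∧ j ≠ k ∧ i ≠ k := by decide
  obtain ⟨i, j, h1, h2, h3⟩ := this k
  obtain ⟨r, r1, r2, r3, -⟩ := s.param hx h1 h2 h3
  intro h0
  apply s.lne x hx i j h1
  rw [r1, r2, mul_div_cancel_right₀ _ (s.vpos x hx i).ne', mul_div_cancel_right₀ _ (s.vpos x hx j).ne']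
  linear_combination r * s.sum' hx h1 h2 h3 - r * h0

lemma step1 (s : Orig W c K v V h) (k : Fin 3) (hk : ∀ y ∈ W, af v k y = 1) {x : E3}
    (hx : x ∈ W) : False := by
  have : ∀ k : Fin 3, ∃ i j, i ≠ j ∧ j ≠ k ∧ i ≠ k := by decide
  obtain ⟨i, j, h1, h2, h3⟩ := this k
  have vn : ∀ y ∈ W, ∀ l, v l y ≠ 0 := fun y hy l => (s.vpos y hy l).ne'
  have vk0 : ∀ y ∈ W, ∀ l d, PD (v k) l y d → d = 0 := by
    intro y hy l d hd
    have := PD.eq_zero s.hW hy hk (hd.sq.cmul (delta k))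
    have h5 : delta k * (2 * v k y) ≠ 0 :=
      mul_ne_zero (delta_ne k) (mul_ne_zero two_ne_zero (vn y hy k))
    exact (mul_eq_zero.mp (by linear_combination this : delta k * (2 * v k y) * d = 0)).resolve_left h5
  have Vk : ∀ y ∈ W, V k y ^ 2 = delta k * (K / 2) := by
    intro y hy
    obtain ⟨r, r1, r2, r3, r4⟩ := s.param hy h1 h2 h3
    have hs := s.sum' hy h1 h2 h3
    have hk1 := hk y hy
    have hj : af v j y = - af v i y := by linarith
    rw [r3, ← r4, hk1, hj]
    have hv : v k y ^ 2 = delta k := by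
      have h6 := delta_sq k
      unfold af at hk1
      linear_combination delta k * hk1 - v k y ^ 2 * h6
    unfold DD pf
    linear_combination (r * (2 * af v i y)) ^ 2 * hv
  have Vk0 : ∀ y ∈ W, ∀ l d, PD (V k) l y d → d = 0 := by
    intro y hy l d hd
    have := PD.eq_zero s.hW hy Vk hd.sq
    exact (mul_eq_zero.mp this).resolve_left (mul_ne_zero two_ne_zero (s.Vne y hy k))
  have hik : ∀ y ∈ W, h i k y = 0 := fun y hy =>
    (mul_eq_zero.mp (vk0 y hy _ _ (s.dv y hy i k h3))).resolve_right (vn y hy i)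
  have hjk : ∀ y ∈ W, h j k y = 0 := fun y hy =>
    (mul_eq_zero.mp (vk0 y hy _ _ (s.dv y hy j k h2))).resolve_right (vn y hy j)
  have hki : ∀ y ∈ W, h k i y = 0 ∧ h k j y = 0 := by
    intro y hy
    have u1 := (mul_eq_zero.mp (vk0 y hy _ _ (s.dv' y hy k i j h3.symm h1 h2.symm))).resolve_left
      (neg_ne_zero.2 (delta_ne k))
    have u2 := (mul_eq_zero.mp (Vk0 y hy _ _ (s.dV' y hy k i j h3.symm h1 h2.symm))).resolve_left
      (neg_ne_zero.2 (delta_ne k))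
    have hl := s.lne y hy i j h1
    rw [ne_eq, div_eq_div_iff (vn y hy i) (vn y hy j)] at hl
    have hl' := sub_ne_zero.2 hl
    constructor
    · have : delta i * (V i y * v j y - V j y * v i y) * h k i y = 0 := by
        linear_combination v j y * u2 - V j y * u1
      exact (mul_eq_zero.mp this).resolve_left (mul_ne_zero (delta_ne i) hl')
    · have : delta j * (V i y * v j y - V j y * v i y) * h k j y = 0 := by
        linear_combination V i y * u1 - v i y * u2
      exact (mul_eq_zero.mp this).resolve_left (mul_ne_zero (delta_ne j) hl')
  have z : ∀ {p q : Fin 3} (l : Fin 3), (∀ y ∈ W, h p q y = 0) → PD (h p q) l x 0 := by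
    intro p q l h0
    exact PD.congr s.hW hx (fun y hy => (h0 y hy).symm) (PD.const 0 l x)
  have w1 := s.g2 x hx i k j h3 h2.symm h1 _ _ (z i hik) (z k fun y hy => (hki y hy).1)
  have w2 := s.g2 x hx j k i h2 h3.symm h1.symm _ _ (z j hjk) (z k fun y hy => (hki y hy).2)
  rw [hjk x hx] at w1
  rw [hik x hx] at w2
  have w3 : V k x * (V i x * v j x - V j x * v i x) = 0 := by
    linear_combination v j x * w1 - v i x * w2
  have hl := s.lne x hx i j h1
  rw [ne_eq, div_eq_div_iff (vn x hx i) (vn x hx j)] at hl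
  exact mul_ne_zero (s.Vne x hx k) (sub_ne_zero.2 hl) w3

lemma Ri (s : Orig W c K v V h) {x : E3} (hx : x ∈ W) {i j k : Fin 3} (h1 : i ≠ j) (h2 : j ≠ k)
    (h3 : i ≠ k) : h i j x * v k x * pf (af v k x) = h i k x * v j x * pf (af v j x) := by
  obtain ⟨r, r1, r2, r3, r4⟩ := s.param hx h1 h2 h3
  have hr : r ≠ 0 := by
    rintro rfl
    exact s.Vne x hx i (by rw [r1]; ring)
  have hz : ∀ y ∈ W, V i y * v j y * v k y + V j y * (v i y * v k y) + V k y * (v i y * v j y)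
      = 0 := by
    intro y hy
    obtain ⟨r, r1, r2, r3, r4⟩ := s.param hy h1 h2 h3
    rw [r1, r2, r3]; ring
  have q := PD.eq_zero s.hW hx hz (((((s.dV' x hx i j k h1 h2 h3).mul (s.dv x hx i j h1)).mul
    (s.dv x hx i k h3)).add ((s.dV x hx i j h1).mul ((s.dv' x hx i j k h1 h2 h3).mul
      (s.dv x hx i k h3)))).add ((s.dV x hx i k h3).mul ((s.dv' x hx i j k h1 h2 h3).mul
      (s.dv x hx i j h1))))
  rw [r1, r2, r3] at q
  refine R_pure (delta i) (delta j) (delta k) (v i x) (v j x) (v k x) r _ _ (delta_sq i) hr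
    (s.sum' hx h1 h2 h3) ?_
  unfold af at q
  linear_combination q

end Orig

lemma eps_eq {e v a : ℝ} (he : e ^ 2 = 1) (hv : v ≠ 0) (ha : a = e * v ^ 2) : e / a = 1 / v ^ 2 := by
  have h0 : e ≠ 0 := by rintro rfl; norm_num at he
  rw [ha]
  field_simp

lemma gauss_pure (ai aj ak pi pj pk vi vj vk ti tj tk Xi Xj c S : ℝ) (hai : ai ≠ 0) (haj : aj ≠ 0)
    (hak : ak ≠ 0) (hvi : vi ≠ 0) (hvj : vj ≠ 0) (hvk : vk ≠ 0)
    (hpi : pf ai = pi) (hpj : pf aj = pj) (hpk : pf ak = pk)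
    (q : (((Xi * vj + ti * (ti * pj * vj)) * pj
            + ti * vj * ((4 - 6 * aj) * (2 * ti * aj * pj))) * vi
          - ti * vj * pj * (-(ti * vi * (aj * pj + ak * pk) / ai))) / vi ^ 2
        + (((Xj * vi + tj * (tj * pi * vi)) * pi
            + tj * vi * ((4 - 6 * ai) * (2 * tj * ai * pi))) * vj
          - tj * vi * pi * (-(tj * vj * (ai * pi + ak * pk) / aj))) / vj ^ 2
        + tk * vi * pi / vk * (tk * vj * pj / vk) + S * (aj - ak) * (ak - ai) * (vi * vj)
        + c * (vi * vj) = 0) :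
    EQ ai aj ak (Xi * (1 / vi ^ 2)) (Xj * (1 / vj ^ 2)) (ti ^ 2 / ai * (1 / vi ^ 2))
      (tj ^ 2 / aj * (1 / vj ^ 2)) (tk ^ 2 / ak * (1 / vk ^ 2)) c S = 0 := by
  apply mul_left_cancel₀ (mul_ne_zero hvi hvj)
  rw [mul_zero, ← q]
  unfold EQ
  rw [hpi, hpj, hpk]
  field_simp
  ring

namespace Orig

variable {W : Set E3} {c K : ℝ} {v V : Fin 3 → E3 → ℝ} {h : Fin 3 → Fin 3 → E3 → ℝ}

lemma sa (s : Orig W c K v V h) (i : Fin 3) : ContDiffOn ℝ (⊤ : ℕ∞) (af v i) W :=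
  contDiffOn_const.mul ((s.sv i).pow 2)

lemma spf (s : Orig W c K v V h) (i : Fin 3) :
    ContDiffOn ℝ (⊤ : ℕ∞) (fun x => pf (af v i x)) W := by
  unfold pf
  exact ((contDiffOn_const.mul (s.sa i)).sub contDiffOn_const).mul
    (contDiffOn_const.sub (s.sa i))

end Orig

noncomputable def tf (v : Fin 3 → E3 → ℝ) (h : Fin 3 → Fin 3 → E3 → ℝ) (i : Fin 3) (x : E3) : ℝ :=
  h i (i + 1) x * v i x / (v (i + 1) x * pf (af v (i + 1) x))

namespace Orig

variable {W : Set E3} {c K : ℝ} {v V : Fin 3 → E3 → ℝ} {h : Fin 3 → Fin 3 → E3 → ℝ}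

lemma tf_eq (s : Orig W c K v V h) (hp : ∀ y ∈ W, ∀ i, pf (af v i y) ≠ 0) {x : E3} (hx : x ∈ W)
    {i j : Fin 3} (hij : i ≠ j) : tf v h i x = h i j x * v i x / (v j x * pf (af v j x)) := by
  have hi : ∀ i : Fin 3, i ≠ i + 1 := by decide
  have vn : ∀ l, v l x ≠ 0 := fun l => (s.vpos x hx l).ne'
  unfold tf
  by_cases e : i + 1 = j
  · rw [e]
  · have R := s.Ri hx (hi i) e hij
    rw [div_eq_div_iff (mul_ne_zero (vn _) (hp x hx _)) (mul_ne_zero (vn _) (hp x hx _))]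
    linear_combination v i x * R

lemma h_eq (s : Orig W c K v V h) (hp : ∀ y ∈ W, ∀ i, pf (af v i y) ≠ 0) {x : E3} (hx : x ∈ W)
    {i j : Fin 3} (hij : i ≠ j) : h i j x = tf v h i x * v j x * pf (af v j x) / v i x := by
  have := (s.vpos x hx i).ne'
  have := (s.vpos x hx j).ne'
  have := hp x hx j
  rw [s.tf_eq hp hx hij]
  field_simp

lemma tv (s : Orig W c K v V h) (hp : ∀ y ∈ W, ∀ i, pf (af v i y) ≠ 0) {x : E3} (hx : x ∈ W)
    {i j : Fin 3} (hij : i ≠ j) : PD (v j) i x (tf v h i x * pf (af v j x) * v j x) := by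
  refine (s.dv x hx i j hij).of_eq ?_
  have := (s.vpos x hx i).ne'
  rw [s.h_eq hp hx hij]
  field_simp

lemma tv' (s : Orig W c K v V h) (hp : ∀ y ∈ W, ∀ i, pf (af v i y) ≠ 0) {x : E3} (hx : x ∈ W)
    {i j k : Fin 3} (h1 : i ≠ j) (h2 : j ≠ k) (h3 : i ≠ k) : PD (v i) i x
      (-(tf v h i x * v i x * (af v j x * pf (af v j x) + af v k x * pf (af v k x))
        / af v i x)) := by
  refine (s.dv' x hx i j k h1 h2 h3).of_eq ?_
  have h4 := (s.vpos x hx i).ne'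
  have h5 := eps_eq (delta_sq i) h4 (rfl : af v i x = _)
  have h6 := s.a_ne hx i
  rw [s.h_eq hp hx h1, s.h_eq hp hx h3]
  have h7 : delta i = af v i x / v i x ^ 2 := by unfold af; field_simp
  have h8 : 1 / af v i x = delta i / v i x ^ 2 := by
    rw [div_eq_div_iff h6 (pow_ne_zero 2 h4)]
    have := delta_sq i
    unfold af
    linear_combination -v i x ^ 2 * this
  rw [div_eq_mul_one_div _ (af v i x), h8]
  generalize hP : pf (af v j x) = P
  generalize hQ : pf (af v k x) = Q
  unfold af
  field_simp

lemma ta (s : Orig W c K v V h) (hp : ∀ y ∈ W, ∀ i, pf (af v i y) ≠ 0) {x : E3} (hx : x ∈ W)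
    {i j : Fin 3} (hij : i ≠ j) :
    PD (af v j) i x (2 * tf v h i x * af v j x * pf (af v j x)) := by
  refine PD.of_eq (f := af v j) ((s.tv hp hx hij).sq.cmul (delta j)) ?_
  generalize pf (af v j x) = P
  unfold af
  ring

lemma ta' (s : Orig W c K v V h) (hp : ∀ y ∈ W, ∀ i, pf (af v i y) ≠ 0) {x : E3} (hx : x ∈ W)
    {i j k : Fin 3} (h1 : i ≠ j) (h2 : j ≠ k) (h3 : i ≠ k) :
    PD (af v i) i x (-2 * tf v h i x * (af v j x * pf (af v j x) + af v k x * pf (af v k x))) := by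
  refine PD.of_eq (f := af v i) ((s.tv' hp hx h1 h2 h3).sq.cmul (delta i)) ?_
  generalize af v j x * pf (af v j x) + af v k x * pf (af v k x) = P
  have h4 := (s.vpos x hx i).ne'
  have := delta_ne i
  unfold af
  field_simp

lemma tt (s : Orig W c K v V h) (hp : ∀ y ∈ W, ∀ i, pf (af v i y) ≠ 0) {x : E3} (hx : x ∈ W)
    {i j k : Fin 3} (h1 : i ≠ j) (h2 : j ≠ k) (h3 : i ≠ k) :
    PD (tf v h i) k x (tf v h i x * tf v h k x * ef (af v i x) (af v j x) (af v k x)) := by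
  have vi := (s.vpos x hx i).ne'
  have vj := (s.vpos x hx j).ne'
  have vk := (s.vpos x hx k).ne'
  have pj := hp x hx j
  have q := ((s.g3 x hx i k j h3 h2.symm h1).mul (s.tv hp hx h3.symm)).div
    ((s.tv hp hx h2.symm).mul (s.ta hp hx h2.symm).pf) (mul_ne_zero vj pj)
  refine (PD.congr s.hW hx (fun y hy => (s.tf_eq hp hy h1).symm) q).of_eq ?_
  rw [s.h_eq hp hx h1, s.h_eq hp hx h3, s.h_eq hp hx h2.symm]
  unfold ef
  generalize pf (af v j x) = P at *
  generalize pf (af v i x) = Q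
  generalize pf (af v k x) = R
  field_simp
  ring

lemma hd (s : Orig W c K v V h) (hp : ∀ y ∈ W, ∀ i, pf (af v i y) ≠ 0)
    (hs : ∀ i, ContDiffOn ℝ (⊤ : ℕ∞) (tf v h i) W) {x : E3} (hx : x ∈ W)
    {i j k : Fin 3} (h1 : i ≠ j) (h2 : j ≠ k) (h3 : i ≠ k) : PD (h i j) i x
      ((((fderiv ℝ (tf v h i) x (Pi.single i 1) * v j x
            + tf v h i x * (tf v h i x * pf (af v j x) * v j x)) * pf (af v j x)
          + tf v h i x * v j x * ((4 - 6 * af v j x) *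
            (2 * tf v h i x * af v j x * pf (af v j x)))) * v i x
        - tf v h i x * v j x * pf (af v j x) *
          (-(tf v h i x * v i x * (af v j x * pf (af v j x) + af v k x * pf (af v k x))
            / af v i x))) / v i x ^ 2) :=
  PD.congr s.hW hx (fun _ hy => (s.h_eq hp hy h1).symm)
    ((((PD.of_smooth s.hW (hs i) hx i).mul (s.tv hp hx h1)).mul (s.ta hp hx h1).pf).div
      (s.tv' hp hx h1 h2 h3) (s.vpos x hx i).ne')

lemma toSys (s : Orig W c K v V h) (hp : ∀ y ∈ W, ∀ i, pf (af v i y) ≠ 0) :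
    Sys W c K delta (af v) (tf v h) := by
  have hi : ∀ i : Fin 3, i ≠ i + 1 := by decide
  have hs : ∀ i, ContDiffOn ℝ (⊤ : ℕ∞) (tf v h i) W := fun i =>
    ((s.sh i (i + 1) (hi i)).mul (s.sv i)).div ((s.sv _).mul (s.spf _))
      (fun y hy => mul_ne_zero (s.vpos y hy _).ne' (hp y hy _))
  refine ⟨s.hW, s.hK, s.sa, hs, s.e1, fun x hx => s.a_ne hx, hp, fun x hx i j => s.d_ne hx,
    fun x hx => s.D_ne hx (by decide) (by decide) (by decide), fun x hx i j => s.ta hp hx,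
    fun x hx i j k => s.ta' hp hx, fun x hx i j k => s.tt hp hx, ?_⟩
  intro x hx i j k h1 h2 h3
  obtain ⟨r, r1, r2, r3, r4⟩ := s.param hx h1 h2 h3
  have hD := s.D_ne hx h1 h2 h3
  have hS : Sf K (af v) x = r ^ 2 := by
    unfold Sf
    rw [← DD_perm (af v) x h1 h2 h3, ← r4, mul_div_cancel_right₀ _ hD]
  have vn : ∀ l, v l x ≠ 0 := fun l => (s.vpos x hx l).ne'
  have hz : ∀ l, zf delta (af v) (tf v h) l x
      = fderiv ℝ (tf v h l) x (Pi.single l 1) * (1 / v l x ^ 2) := by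
    intro l
    rw [← eps_eq (delta_sq l) (vn l) (rfl : af v l x = _)]
    unfold zf
    ring
  have hr : ∀ l, rf delta (af v) (tf v h) l x
      = tf v h l x ^ 2 / af v l x * (1 / v l x ^ 2) := by
    intro l
    rw [← eps_eq (delta_sq l) (vn l) (rfl : af v l x = _)]
    unfold rf
    have := s.a_ne hx l
    field_simp
  rw [hz, hz, hr, hr, hr, hS]
  have q := s.g2 x hx i j k h1 h2 h3 _ _ (s.hd hp hs hx h1 h2 h3)
    (s.hd hp hs hx h1.symm h3 h2)
  rw [s.h_eq hp hx h3.symm, s.h_eq hp hx h2.symm, r1, r2] at q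
  refine gauss_pure _ _ _ _ _ _ (v i x) (v j x) (v k x) _ _ _ _ _ _ _ (s.a_ne hx i) (s.a_ne hx j)
    (s.a_ne hx k) (vn i) (vn j) (vn k) rfl rfl rfl ?_
  rw [← q]
  ring

lemma contra0 (s : Orig W c K v V h) {x : E3} (hx : x ∈ W) : False := by
  have key : ∀ (k : Fin 3) {W' : Set E3}, Orig W' c K v V h → W'.Nonempty →
      ∃ W'', Orig W'' c K v V h ∧ W''.Nonempty ∧ W'' ⊆ W' ∧ ∀ y ∈ W'', 1 - af v k y ≠ 0 := by
    rintro k W' s' ⟨x', hx'⟩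
    have ho := open_ne s'.hW ((contDiffOn_const (c := (1 : ℝ))).sub (s'.sa k))
    refine ⟨_, s'.mono ho Set.inter_subset_left, ?_, Set.inter_subset_left, fun y hy => hy.2⟩
    by_contra hne
    refine s'.step1 k (fun y hy => ?_) hx'
    by_contra h0
    exact hne ⟨y, hy, fun h1 => h0 (by linarith)⟩
  obtain ⟨W0, s0, n0, -, p0⟩ := key 0 s ⟨x, hx⟩
  obtain ⟨W1, s1, n1, i1, p1⟩ := key 1 s0 n0
  obtain ⟨W2, s2, ⟨y, hy⟩, i2, p2⟩ := key 2 s1 n1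
  refine (s2.toSys fun z hz i => mul_ne_zero (s2.a3_ne hz i) ?_).contra hy
  revert i
  rw [Fin.forall_fin_succ, Fin.forall_fin_succ, Fin.forall_fin_succ]
  exact ⟨p0 z (i1 (i2 hz)), p1 z (i2 hz), p2 z hz, fun i => i.elim0⟩

end Orig

/-- there is no nonempty open set U ⊆ ℝ³, constants c ≠ c̃, and
smooth functions vᵢ, Vᵢ, h_{ij} on U satisfying: vᵢ > 0, Vᵢ ≠ 0, pairwise
distinct principal curvatures Vᵢ/vᵢ, the algebraic system (⋆), and the PDE
system (i)–(vi).  Partial derivatives in the j-th coordinate direction are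
`fderiv ℝ f x (Pi.single j 1)`. -/
theorem stmt_0 :
    ¬ ∃ (U : Set (Fin 3 → ℝ)) (c ct : ℝ)
        (v V : Fin 3 → (Fin 3 → ℝ) → ℝ)
        (h : Fin 3 → Fin 3 → (Fin 3 → ℝ) → ℝ),
      IsOpen U ∧ U.Nonempty ∧ c ≠ ct ∧
      (∀ i, ContDiffOn ℝ (⊤ : ℕ∞) (v i) U) ∧
      (∀ i, ContDiffOn ℝ (⊤ : ℕ∞) (V i) U) ∧
      (∀ i j, i ≠ j → ContDiffOn ℝ (⊤ : ℕ∞) (h i j) U) ∧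
      (∀ x ∈ U,
        (∀ i, 0 < v i x) ∧
        (∀ i, V i x ≠ 0) ∧
        (∀ i j, i ≠ j → V i x / v i x ≠ V j x / v j x) ∧
        -- the system (⋆)
        (v 0 x) ^ 2 - (v 1 x) ^ 2 + (v 2 x) ^ 2 = 1 ∧
        v 0 x * V 0 x - v 1 x * V 1 x + v 2 x * V 2 x = 0 ∧
        (V 0 x) ^ 2 - (V 1 x) ^ 2 + (V 2 x) ^ 2 = c - ct ∧
        V 0 x / v 0 x + V 1 x / v 1 x + V 2 x / v 2 x = 0 ∧
        -- (i)
        (∀ i j, i ≠ j →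
          fderiv ℝ (v i) x (Pi.single j 1) = h j i x * v j x) ∧
        -- (ii)
        (∀ i j k, i ≠ j → j ≠ k → i ≠ k →
          fderiv ℝ (h i j) x (Pi.single i 1)
            + fderiv ℝ (h j i) x (Pi.single j 1)
            + h k i x * h k j x + V i x * V j x + c * (v i x * v j x) = 0) ∧
        -- (iii)
        (∀ i j k, i ≠ j → j ≠ k → i ≠ k →
          fderiv ℝ (h i k) x (Pi.single j 1) = h i j x * h j k x) ∧
        -- (iv)
        (∀ i j, i ≠ j →
          fderiv ℝ (V i) x (Pi.single j 1) = h j i x * V j x) ∧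
        -- (v)
        (∀ i j k, i ≠ j → j ≠ k → i ≠ k →
          delta i * fderiv ℝ (v i) x (Pi.single i 1)
            + delta j * (h i j x * v j x) + delta k * (h i k x * v k x) = 0) ∧
        -- (vi)
        (∀ i j k, i ≠ j → j ≠ k → i ≠ k →
          delta i * fderiv ℝ (V i) x (Pi.single i 1)
            + delta j * (h i j x * V j x) + delta k * (h i k x * V k x) = 0)) := by
  rintro ⟨U, c, ct, v, V, h, hU, ⟨x, hx⟩, hc, sv, sV, sh, H⟩
  have s : Orig U c (c - ct) v V h := by
    refine ⟨hU, sub_ne_zero.2 hc, sv, sV, sh, fun x hx => (H x hx).1, fun x hx => (H x hx).2.1,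
      fun x hx => (H x hx).2.2.1, ?_, ?_, ?_, fun x hx => (H x hx).2.2.2.2.2.2.1, ?_, ?_, ?_, ?_,
      ?_, ?_⟩
    all_goals
      intro x hx
      obtain ⟨h1, h2, h3, h4, h5, h6, h7, i1, i2, i3, i4, i5, i6⟩ := H x hx
    · simp only [af, delta, Matrix.cons_val]
      linear_combination h4
    · simp only [delta, Matrix.cons_val]
      linear_combination h5
    · simp only [delta, Matrix.cons_val]
      linear_combination h6
    · intro i j hij
      exact (PD.of_smooth hU (sv j) hx i).of_eq (i1 j i hij.symm)
    · intro i j hij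
      exact (PD.of_smooth hU (sV j) hx i).of_eq (i4 j i hij.symm)
    · intro i j k hij hjk hik
      refine (PD.of_smooth hU (sv i) hx i).of_eq ?_
      linear_combination delta i * i5 i j k hij hjk hik
        - fderiv ℝ (v i) x (Pi.single i 1) * delta_sq i
    · intro i j k hij hjk hik
      refine (PD.of_smooth hU (sV i) hx i).of_eq ?_
      linear_combination delta i * i6 i j k hij hjk hik
        - fderiv ℝ (V i) x (Pi.single i 1) * delta_sq i
    · intro i j k hij hjk hik d e hd he
      rw [hd.unique (PD.of_smooth hU (sh i j hij) hx i),
        he.unique (PD.of_smooth hU (sh j i hij.symm) hx j)]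
      exact i2 i j k hij hjk hik
    · intro i j k hij hjk hik
      exact (PD.of_smooth hU (sh i k hik) hx j).of_eq (i3 i j k hij hjk hik)
  exact s.contra0 hx
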